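/- arXiv:2004.06807 — 14 statements merged into one kernel-verified Lean document; each statement's English description precedes it below -/
import Mathlib

section
/- Let k < 0, ν ≥ 0, γ > 0, and set λ = (ν + √(ν² - 4kγ))/2 and μ = (-ν + √(ν² - 4kγ))/2. Let T ∈ (0, ∞] and let ξ : [0, T) → ℝ be differentiable with ξ'(t) = -ξ(t)² - ν ξ(t) - kγ for all t ∈ [0, T). If ξ(0) ≥ -λ, then -λ ≤ ξ(t) ≤ max{ξ(0), μ} for all t ∈ [0, T). -/
/-- A solution of `ξ' = -(ξ + lam) (ξ - mu)` starting above the lower equilibrium `-lam`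
stays above it. -/
lemma neg_le_of_riccati {lam mu b : ℝ} {ξ : ℝ → ℝ} (hsum : 0 ≤ lam + mu) (hb : 0 ≤ b)
    (hode : ∀ t ∈ Set.Icc 0 b,
      HasDerivWithinAt ξ (-(ξ t + lam) * (ξ t - mu)) (Set.Icc 0 b) t)
    (hinit : -lam ≤ ξ 0) : -lam ≤ ξ b := by
  refine le_of_forall_pos_lt_add fun ε hε => ?_
  obtain ⟨δ, hδ, hδε⟩ := exists_between (lt_min hε one_pos)
  obtain ⟨hδε, hδ1⟩ := lt_min_iff.1 hδε
  have key := image_le_of_deriv_right_lt_deriv_boundary' (f := fun s => -ξ s)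
    (f' := fun s => -(-(ξ s + lam) * (ξ s - mu)))
    (B := fun s => lam + δ * Real.exp ((lam + mu + 2) * (s - b)))
    (B' := fun s => δ * (Real.exp ((lam + mu + 2) * (s - b)) * ((lam + mu + 2) * 1)))
    (a := 0) (b := b) (fun s hs => (hode s hs).continuousWithinAt.neg)
    (fun s hs => ((hode s ⟨hs.1, hs.2.le⟩).mono_of_mem_nhdsWithin
      (Icc_mem_nhdsGE_of_mem hs)).neg)
    (by nlinarith [mul_pos hδ (Real.exp_pos ((lam + mu + 2) * (0 - b)))])
    (by fun_prop)
    (fun s _ => (((((hasDerivAt_id s).sub_const b).const_mul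
      (lam + mu + 2)).exp.const_mul δ).const_add lam).hasDerivWithinAt)
    (fun s hs heq => by
      have he : Real.exp ((lam + mu + 2) * (s - b)) ≤ 1 :=
        Real.exp_le_one_iff.2 (mul_nonpos_of_nonneg_of_nonpos (by linarith) (by linarith [hs.2]))
      have hpos := Real.exp_pos ((lam + mu + 2) * (s - b))
      set e := Real.exp ((lam + mu + 2) * (s - b))
      have hξ : ξ s = -lam - δ * e := by linarith
      have hlt : δ * e < 2 := by nlinarith
      have hde := mul_pos hδ hpos
      rw [hξ]
      nlinarith [mul_pos hde (sub_pos.2 hlt)])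
    (Set.right_mem_Icc.2 hb)
  simp only [sub_self, mul_zero, Real.exp_zero, mul_one] at key
  linarith

/-- A solution of `ξ' = -(ξ + lam) (ξ - mu)` with `-lam ≤ mu` is bounded by the larger of its
initial value and the upper equilibrium `mu`. -/
lemma le_max_of_riccati {lam mu b : ℝ} {ξ : ℝ → ℝ} (hsum : 0 ≤ lam + mu) (hb : 0 ≤ b)
    (hode : ∀ t ∈ Set.Icc 0 b,
      HasDerivWithinAt ξ (-(ξ t + lam) * (ξ t - mu)) (Set.Icc 0 b) t) :
    ξ b ≤ max (ξ 0) mu := by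
  refine le_of_forall_pos_le_add fun ε hε => ?_
  exact image_le_of_deriv_right_lt_deriv_boundary' (f := ξ)
    (f' := fun s => -(ξ s + lam) * (ξ s - mu))
    (B := fun _ => max (ξ 0) mu + ε) (B' := fun _ => 0)
    (a := 0) (b := b) (fun s hs => (hode s hs).continuousWithinAt)
    (fun s hs => (hode s ⟨hs.1, hs.2.le⟩).mono_of_mem_nhdsWithin
      (Icc_mem_nhdsGE_of_mem hs))
    (by linarith [le_max_left (ξ 0) mu])
    continuousOn_const
    (fun s _ => hasDerivWithinAt_const _ _ _)
    (fun s _ heq => by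
      have hmu : 0 < ξ s - mu := by linarith [le_max_right (ξ 0) mu]
      have hlam : 0 < ξ s + lam := by linarith
      nlinarith [mul_pos hlam hmu])
    (Set.right_mem_Icc.2 hb)

/-- phase-line bounds for the Riccati equation
`ξ' = -ξ² - νξ - kγ` on `[0, T)` with `T ∈ (0, ∞]`.
If `ξ(0) ≥ -λ` then `-λ ≤ ξ(t) ≤ max{ξ(0), μ}` on `[0, T)`. -/
theorem riccati_bounds
    (k ν γ : ℝ) (hk : k < 0) (hν : 0 ≤ ν) (hγ : 0 < γ)
    (lam mu : ℝ)
    (hlam : lam = (ν + Real.sqrt (ν ^ 2 - 4 * k * γ)) / 2)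
    (hmu : mu = (-ν + Real.sqrt (ν ^ 2 - 4 * k * γ)) / 2)
    (T : EReal) (hT : 0 < T)
    (ξ : ℝ → ℝ)
    (hode : ∀ t : ℝ, 0 ≤ t → (t : EReal) < T →
      HasDerivWithinAt ξ (-(ξ t) ^ 2 - ν * ξ t - k * γ)
        {s : ℝ | 0 ≤ s ∧ (s : EReal) < T} t)
    (hinit : -lam ≤ ξ 0) :
    ∀ t : ℝ, 0 ≤ t → (t : EReal) < T →
      -lam ≤ ξ t ∧ ξ t ≤ max (ξ 0) mu := by
  intro b hb hbT
  have hdisc : 0 ≤ ν ^ 2 - 4 * k * γ := by nlinarith [sq_nonneg ν, mul_neg_of_neg_of_pos hk hγ]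
  have hsqrt := Real.sq_sqrt hdisc
  have hsum : 0 ≤ lam + mu := by
    linarith [Real.sqrt_nonneg (ν ^ 2 - 4 * k * γ)]
  have hode' : ∀ t ∈ Set.Icc 0 b,
      HasDerivWithinAt ξ (-(ξ t + lam) * (ξ t - mu)) (Set.Icc 0 b) t := fun t ht => by
    have hlt : ∀ s ≤ b, (s : EReal) < T := fun s hs =>
      (EReal.coe_le_coe_iff.2 hs).trans_lt hbT
    have hd := (hode t ht.1 (hlt t ht.2)).mono fun s (hs : s ∈ Set.Icc 0 b) =>
      ⟨hs.1, hlt s hs.2⟩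
    refine hd.congr_deriv ?_
    rw [hlam, hmu]
    linear_combination -hsqrt / 4
  exact ⟨neg_le_of_riccati hsum hb hode' hinit, le_max_of_riccati hsum hb hode'⟩
end

section
/- Let k < 0, ν ≥ 0, γ > 0, and set λ = (ν + √(ν² - 4kγ))/2. If ξ₀ < -λ, then there is no differentiable function ξ : [0, ∞) → ℝ satisfying ξ(0) = ξ₀ and ξ'(t) = -ξ(t)² - ν ξ(t) - kγ for all t ≥ 0; that is, the solution of this Riccati equation blows up (tends to -∞) in finite time. -/
/-- A function on `[0, ∞)` starting from a positive value cannot satisfy `y' ≥ y ^ 2` wherever it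
is positive. -/
theorem not_forall_sq_le_deriv_of_pos {y y' : ℝ → ℝ} (h0 : 0 < y 0)
    (hy : ∀ t, 0 ≤ t → HasDerivWithinAt y (y' t) (Set.Ici 0) t) :
    ¬ ∀ t, 0 ≤ t → 0 < y t → y t ^ 2 ≤ y' t := by
  intro hle
  have hge : ∀ t, 0 ≤ t → y 0 ≤ y t := by
    intro t ht
    have h := image_le_of_deriv_right_lt_deriv_boundary (f := fun t => -y t)
      (f' := fun t => -y' t) (B := fun _ => -y 0) (B' := fun _ => 0) (a := 0) (b := t)
      (fun x hx => ((hy x hx.1).neg.continuousWithinAt).mono Set.Icc_subset_Ici_self)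
      (fun x hx => (hy x hx.1).neg.mono (Set.Ici_subset_Ici.2 hx.1)) le_rfl
      (fun x => hasDerivAt_const x _)
      (fun x hx hxy => by
        have hxy : y x = y 0 := neg_injective hxy
        have hpos : 0 < y x := hxy ▸ h0
        have := hle x hx.1 hpos
        have := pow_pos hpos 2
        linarith)
      (Set.right_mem_Icc.2 ht)
    exact neg_le_neg_iff.1 h
  have hpos : ∀ t, 0 ≤ t → 0 < y t := fun t ht => h0.trans_le (hge t ht)
  have hinv : ∀ t, 0 ≤ t →
      HasDerivWithinAt (fun s => (y s)⁻¹) (-y' t / y t ^ 2) (Set.Ici 0) t :=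
    fun t ht => (hy t ht).fun_inv (hpos t ht).ne'
  have hT : 0 ≤ (y 0)⁻¹ := (inv_pos.2 h0).le
  have h := image_le_of_deriv_right_le_deriv_boundary (f := fun t => (y t)⁻¹)
    (f' := fun t => -y' t / y t ^ 2) (B := fun t => (y 0)⁻¹ - t) (B' := fun _ => -1)
    (a := 0) (b := (y 0)⁻¹)
    (fun x hx => ((hinv x hx.1).continuousWithinAt).mono Set.Icc_subset_Ici_self)
    (fun x hx => (hinv x hx.1).mono (Set.Ici_subset_Ici.2 hx.1)) (by simp)
    (by fun_prop)
    (fun x _ => ((hasDerivAt_id x).const_sub _).hasDerivWithinAt)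
    (fun x hx => by
      rw [div_le_iff₀ (pow_pos (hpos x hx.1) 2)]
      linarith [hle x hx.1 (hpos x hx.1)])
    (Set.right_mem_Icc.2 hT)
  have := inv_pos.2 (hpos _ hT)
  simp only [sub_self] at h
  linarith


/-- if `ξ₀ < -λ` then the Riccati equation `ξ' = -ξ² - νξ - kγ`
admits no global differentiable solution on `[0, ∞)` with `ξ(0) = ξ₀`
(the solution blows up in finite time). -/
theorem riccati_blowup
    (k ν γ : ℝ) (hk : k < 0) (hν : 0 ≤ ν) (hγ : 0 < γ)
    (lam : ℝ)
    (hlam : lam = (ν + Real.sqrt (ν ^ 2 - 4 * k * γ)) / 2)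
    (ξ₀ : ℝ) (hinit : ξ₀ < -lam) :
    ¬ ∃ ξ : ℝ → ℝ, ξ 0 = ξ₀ ∧
      ∀ t : ℝ, 0 ≤ t →
        HasDerivWithinAt ξ (-(ξ t) ^ 2 - ν * ξ t - k * γ) (Set.Ici (0 : ℝ)) t := by
  rintro ⟨ξ, hξ0, hξ⟩
  have hsq : Real.sqrt (ν ^ 2 - 4 * k * γ) ^ 2 = ν ^ 2 - 4 * k * γ :=
    Real.sq_sqrt (by nlinarith [mul_pos (neg_pos.2 hk) hγ, sq_nonneg ν])
  have hs := Real.sqrt_nonneg (ν ^ 2 - 4 * k * γ)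
  set s := Real.sqrt (ν ^ 2 - 4 * k * γ)
  refine not_forall_sq_le_deriv_of_pos (y := fun t => -lam - ξ t) (by linarith)
    (fun t ht => (hξ t ht).const_sub (-lam)) fun t _ hpos => ?_
  have hfactor : -(-(ξ t) ^ 2 - ν * ξ t - k * γ) = (-lam - ξ t) ^ 2 + s * (-lam - ξ t) := by
    subst hlam
    linear_combination hsq / 4
  rw [hfactor]
  exact le_add_of_nonneg_right (mul_nonneg hs hpos.le)
end

section
/- Let k < 0, ν ≥ 0, γ > 0, λ = (ν + √(ν² - 4kγ))/2 and μ = (-ν + √(ν² - 4kγ))/2. Let T ∈ (0, ∞] and let η, ξ : [0, T) → ℝ be differentiable with η'(t) = -η(t)ξ(t) and ξ'(t) = -ξ(t)² - ν ξ(t) + k η(t) - kγ for all t ∈ [0, T). If η(0) ≥ 0 and ξ(0) ≥ (λ/γ)(η(0) - γ), then for all t ∈ [0, T): ξ(t) ≥ (λ/γ)(η(t) - γ), 0 ≤ η(t) ≤ η(0) e^{λ t}, and -λ ≤ ξ(t) ≤ max{ξ(0), μ}. -/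
open Set in
/-- Differential Grönwall inequality in sign form: if `g * f ≤ f'` on `[a, b]` with `g` continuous
and `f a` is nonnegative, then so is `f b`. -/
theorem nonneg_of_mul_le_hasDerivWithinAt {f f' g : ℝ → ℝ} {a b : ℝ} (hab : a ≤ b)
    (hf : ∀ x ∈ Icc a b, HasDerivWithinAt f (f' x) (Icc a b) x)
    (hg : ContinuousOn g (Icc a b)) (hfg : ∀ x ∈ Icc a b, g x * f x ≤ f' x) (ha : 0 ≤ f a) :
    0 ≤ f b := by
  set g₀ : ℝ → ℝ := IccExtend hab ((Icc a b).domRestrict g)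
  have hg₀ : Continuous g₀ := (continuousOn_iff_continuous_domRestrict.1 hg).Icc_extend'
  have hG (x : ℝ) : HasDerivAt (fun y ↦ ∫ s in a..y, g₀ s) (g₀ x) x :=
    hg₀.integral_hasStrictDerivAt a x |>.hasDerivAt
  have hF (x : ℝ) (hx : x ∈ Icc a b) :
      HasDerivWithinAt (fun y ↦ f y * Real.exp (-∫ s in a..y, g₀ s))
        ((f' x - g x * f x) * Real.exp (-∫ s in a..x, g₀ s)) (Icc a b) x := by
    have hgx : g₀ x = g x := IccExtend_of_mem hab _ hx
    refine ((hf x hx).mul (hG x).neg.exp.hasDerivWithinAt).congr_deriv ?_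
    rw [hgx, Pi.neg_apply]
    ring
  have hmono : MonotoneOn (fun y ↦ f y * Real.exp (-∫ s in a..y, g₀ s)) (Icc a b) := by
    refine monotoneOn_of_hasDerivWithinAt_nonneg (convex_Icc a b)
      (fun x hx ↦ (hF x hx).continuousWithinAt)
      (fun x hx ↦ (hF x (interior_subset hx)).mono interior_subset) fun x hx ↦ ?_
    exact mul_nonneg (sub_nonneg.2 (hfg x (interior_subset hx))) (Real.exp_pos _).le
  have hle := hmono (left_mem_Icc.2 hab) (right_mem_Icc.2 hab) hab
  exact nonneg_of_mul_nonneg_left ((mul_nonneg ha (Real.exp_pos _).le).trans hle) (Real.exp_pos _)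

/-- subcritical bounds for the auxiliary system
`η' = -ηξ`, `ξ' = -ξ² - νξ + kη - kγ` on `[0, T)` with `T ∈ (0, ∞]`.
If `η(0) ≥ 0` and `ξ(0) ≥ (λ/γ)(η(0) - γ)`, then for all `t ∈ [0, T)`:
`ξ(t) ≥ (λ/γ)(η(t) - γ)`, `0 ≤ η(t) ≤ η(0) e^{λt}`, and `-λ ≤ ξ(t) ≤ max{ξ(0), μ}`. -/
theorem aux_system_bounds
    (k ν γ : ℝ) (hk : k < 0) (hν : 0 ≤ ν) (hγ : 0 < γ)
    (lam mu : ℝ)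
    (hlam : lam = (ν + Real.sqrt (ν ^ 2 - 4 * k * γ)) / 2)
    (hmu : mu = (-ν + Real.sqrt (ν ^ 2 - 4 * k * γ)) / 2)
    (T : EReal) (hT : 0 < T)
    (η ξ : ℝ → ℝ)
    (hodeη : ∀ t : ℝ, 0 ≤ t → (t : EReal) < T →
      HasDerivWithinAt η (-(η t) * ξ t) {s : ℝ | 0 ≤ s ∧ (s : EReal) < T} t)
    (hodeξ : ∀ t : ℝ, 0 ≤ t → (t : EReal) < T →
      HasDerivWithinAt ξ (-(ξ t) ^ 2 - ν * ξ t + k * η t - k * γ)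
        {s : ℝ | 0 ≤ s ∧ (s : EReal) < T} t)
    (hη0 : 0 ≤ η 0)
    (hξ0 : (lam / γ) * (η 0 - γ) ≤ ξ 0) :
    ∀ t : ℝ, 0 ≤ t → (t : EReal) < T →
      (lam / γ) * (η t - γ) ≤ ξ t ∧
      0 ≤ η t ∧ η t ≤ η 0 * Real.exp (lam * t) ∧
      -lam ≤ ξ t ∧ ξ t ≤ max (ξ 0) mu := by
  have hdisc : 0 < -(4 * k * γ) := by nlinarith [mul_pos (neg_pos.2 hk) hγ]
  have hsq := Real.sq_sqrt (show 0 ≤ ν ^ 2 - 4 * k * γ by nlinarith [sq_nonneg ν])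
  have hsqrt : 0 < Real.sqrt (ν ^ 2 - 4 * k * γ) :=
    Real.sqrt_pos.2 (by nlinarith [sq_nonneg ν])
  have hlam_pos : 0 < lam := by rw [hlam]; positivity
  have hν_eq : ν = lam - mu := by rw [hlam, hmu]; ring
  have hprod : k * γ = -(lam * mu) := by rw [hlam, hmu]; linarith
  have hk_eq : k = -(lam / γ * mu) := by field_simp; exact hprod
  have hslope : 0 < lam / γ := div_pos hlam_pos hγ
  have hslopeγ : lam / γ * γ = lam := div_mul_cancel₀ _ hγ.ne'
  set c := lam / γ
  have hsub (t : ℝ) (htT : (t : EReal) < T) :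
      Set.Icc 0 t ⊆ {s : ℝ | 0 ≤ s ∧ (s : EReal) < T} :=
    fun s hs ↦ ⟨hs.1, (EReal.coe_le_coe_iff.2 hs.2).trans_lt htT⟩
  have hη (t : ℝ) (htT : (t : EReal) < T) (x : ℝ) (hx : x ∈ Set.Icc 0 t) :
      HasDerivWithinAt η (-(η x) * ξ x) (Set.Icc 0 t) x :=
    (hodeη x (hsub t htT hx).1 (hsub t htT hx).2).mono (hsub t htT)
  have hξ (t : ℝ) (htT : (t : EReal) < T) (x : ℝ) (hx : x ∈ Set.Icc 0 t) :
      HasDerivWithinAt ξ (-(ξ x) ^ 2 - ν * ξ x + k * η x - k * γ) (Set.Icc 0 t) x :=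
    (hodeξ x (hsub t htT hx).1 (hsub t htT hx).2).mono (hsub t htT)
  have hξc (t : ℝ) (htT : (t : EReal) < T) : ContinuousOn ξ (Set.Icc 0 t) :=
    fun x hx ↦ (hξ t htT x hx).continuousWithinAt
  have hη_nonneg (t : ℝ) (ht : 0 ≤ t) (htT : (t : EReal) < T) : 0 ≤ η t :=
    nonneg_of_mul_le_hasDerivWithinAt (g := fun x ↦ -ξ x) ht (hη t htT) (hξc t htT).neg
      (fun x _ ↦ by linarith) hη0
  have hline (t : ℝ) (ht : 0 ≤ t) (htT : (t : EReal) < T) : c * (η t - γ) ≤ ξ t := by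
    refine sub_nonneg.1 <| nonneg_of_mul_le_hasDerivWithinAt
      (f := fun x ↦ ξ x - c * (η x - γ)) (g := fun x ↦ mu - ξ x) ht
      (fun x hx ↦ (hξ t htT x hx).sub (((hη t htT x hx).sub_const γ).const_mul c))
      (continuousOn_const.sub (hξc t htT)) (fun x _ ↦ le_of_eq ?_) (sub_nonneg.2 hξ0)
    rw [hν_eq, hprod, hk_eq]
    linear_combination (mu - ξ x) * hslopeγ
  have hξ_lower (t : ℝ) (ht : 0 ≤ t) (htT : (t : EReal) < T) : -lam ≤ ξ t := by
    nlinarith [hline t ht htT, mul_nonneg hslope.le (hη_nonneg t ht htT)]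
  intro t ht htT
  refine ⟨hline t ht htT, hη_nonneg t ht htT, ?_, hξ_lower t ht htT, ?_⟩
  · refine sub_nonneg.1 <| nonneg_of_mul_le_hasDerivWithinAt
      (f := fun x ↦ η 0 * Real.exp (lam * x) - η x) (g := fun _ ↦ lam) ht
      (fun x hx ↦ ((((hasDerivAt_id x).const_mul lam).exp.const_mul
        (η 0)).hasDerivWithinAt).sub (hη t htT x hx))
      continuousOn_const (fun x hx ↦ ?_) (by simp)
    have hx' := (hsub t htT hx).2
    have := mul_nonneg (hη_nonneg x hx.1 hx') (neg_le_iff_add_nonneg.1 (hξ_lower x hx.1 hx'))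
    simp only [id]
    linarith
  · refine sub_nonneg.1 <| nonneg_of_mul_le_hasDerivWithinAt
      (f := fun x ↦ max (ξ 0) mu - ξ x) (g := fun x ↦ -(ξ x + lam)) ht
      (fun x hx ↦ (hξ t htT x hx).const_sub _)
      ((hξc t htT).add continuousOn_const).neg (fun x hx ↦ ?_) (sub_nonneg.2 (le_max_left _ _))
    have hx' := (hsub t htT hx).2
    have hdamp := mul_nonneg (neg_le_iff_add_nonneg.1 (hξ_lower x hx.1 hx'))
      (sub_nonneg.2 (le_max_right (ξ 0) mu))
    have hforce := mul_nonneg (neg_nonneg.2 hk.le) (hη_nonneg x hx.1 hx')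
    rw [hν_eq, hprod]
    linarith
end

section
/- Let k < 0, ν ≥ 0, γ > 0, and λ = (ν + √(ν² - 4kγ))/2. Suppose η₀ ≥ 0 and ξ₀ < (λ/γ)(η₀ - γ). Then there do not exist differentiable functions η, ξ : [0, ∞) → ℝ with η(0) = η₀, ξ(0) = ξ₀ satisfying η'(t) = -η(t)ξ(t) and ξ'(t) = -ξ(t)² - ν ξ(t) + k η(t) - kγ for all t ≥ 0; that is, the solution of the auxiliary system blows up (η → +∞ and ξ → -∞) in finite time. -/
open Set in
/-- A function on `[0, ∞)` with nonpositive derivative is bounded by its initial value. -/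
lemma le_initial_of_hasDerivWithinAt_nonpos {f f' : ℝ → ℝ}
    (hf : ∀ t, 0 ≤ t → HasDerivWithinAt f (f' t) (Ici 0) t)
    (hf' : ∀ t, 0 ≤ t → f' t ≤ 0) {t : ℝ} (ht : 0 ≤ t) : f t ≤ f 0 := by
  refine antitoneOn_of_hasDerivWithinAt_nonpos (f' := f') (convex_Ici (0 : ℝ))
    (fun x hx => (hf x hx).continuousWithinAt) (fun x hx => ?_) (fun x hx => ?_)
    self_mem_Ici ht ht
  · exact (hf x (interior_subset hx)).mono interior_subset
  · exact hf' x (interior_subset hx)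

open Set in
/-- Existence of a positive integrating factor for a function continuous on `[0, ∞)`. -/
lemma exists_pos_hasDerivWithinAt_mul {ξ : ℝ → ℝ} (hξ : ContinuousOn ξ (Ici 0)) :
    ∃ E : ℝ → ℝ, E 0 = 1 ∧ (∀ t, 0 < E t) ∧
      ∀ t, 0 ≤ t → HasDerivWithinAt E (E t * ξ t) (Ici 0) t := by
  have hg : Continuous fun t => ξ (max t 0) :=
    hξ.comp_continuous (by fun_prop) fun t => le_max_right t 0
  refine ⟨fun t => Real.exp (∫ s in (0 : ℝ)..t, ξ (max s 0)), by simp,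
    fun t => Real.exp_pos _, fun t ht => ?_⟩
  simpa [max_eq_left ht] using (hg.integral_hasStrictDerivAt 0 t).hasDerivAt.exp.hasDerivWithinAt

/-- supercritical blow-up for the auxiliary system
`η' = -ηξ`, `ξ' = -ξ² - νξ + kη - kγ`.
If `η₀ ≥ 0` and `ξ₀ < (λ/γ)(η₀ - γ)`, then there is no global differentiable
solution on `[0, ∞)` with data `(η₀, ξ₀)` (the solution blows up in finite time). -/
theorem aux_system_blowup
    (k ν γ : ℝ) (hk : k < 0) (hν : 0 ≤ ν) (hγ : 0 < γ)
    (lam : ℝ)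
    (hlam : lam = (ν + Real.sqrt (ν ^ 2 - 4 * k * γ)) / 2)
    (η₀ ξ₀ : ℝ) (hη0 : 0 ≤ η₀) (hξ0 : ξ₀ < (lam / γ) * (η₀ - γ)) :
    ¬ ∃ η ξ : ℝ → ℝ, η 0 = η₀ ∧ ξ 0 = ξ₀ ∧
      (∀ t : ℝ, 0 ≤ t →
        HasDerivWithinAt η (-(η t) * ξ t) (Set.Ici (0 : ℝ)) t) ∧
      (∀ t : ℝ, 0 ≤ t →
        HasDerivWithinAt ξ (-(ξ t) ^ 2 - ν * ξ t + k * η t - k * γ)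
          (Set.Ici (0 : ℝ)) t) := by
  rintro ⟨η, ξ, rfl, rfl, hη, hξ⟩
  have hkγ : 0 < -(k * γ) := neg_pos.2 (mul_neg_of_neg_of_pos hk hγ)
  have hdisc : 0 ≤ ν ^ 2 - 4 * k * γ := by nlinarith [sq_nonneg ν]
  have hsq := Real.sq_sqrt hdisc
  have hchar : lam * (lam - ν) = -(k * γ) := by
    rw [hlam]; linear_combination hsq / 4
  have hlam0 : 0 ≤ lam := by rw [hlam]; positivity
  have hμ : 0 < lam - ν := pos_of_mul_pos_right (hchar ▸ hkγ) hlam0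
  have hk' : k = -(lam * (lam - ν)) / γ := by
    rw [eq_div_iff hγ.ne']; linarith
  obtain ⟨E, hE0, hEpos, hE⟩ :=
    exists_pos_hasDerivWithinAt_mul fun t ht => (hξ t ht).continuousWithinAt
  have hηE : ∀ t, 0 ≤ t → η t * E t ≤ η 0 := fun t ht => by
    have := le_initial_of_hasDerivWithinAt_nonpos (fun t ht => (hη t ht).mul (hE t ht))
      (fun t _ => le_of_eq (by ring)) ht
    simpa [hE0] using this
  set p₀ := ξ 0 + lam - lam / γ * η 0
  have hp₀neg : p₀ < 0 := by
    have : lam / γ * (η 0 - γ) = lam / γ * η 0 - lam := by field_simp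
    linarith
  have hp : ∀ t, 0 ≤ t →
      E t * (ξ t + lam - lam / γ * η t) ≤ p₀ * Real.exp ((lam - ν) * t) := fun t ht => by
    have hexp : ∀ t : ℝ, HasDerivWithinAt (fun t => Real.exp (-((lam - ν) * t)))
        (Real.exp (-((lam - ν) * t)) * -(lam - ν)) (Set.Ici 0) t := fun t => by
      simpa using ((hasDerivAt_id t).const_mul (lam - ν)).neg.exp.hasDerivWithinAt
    have := le_initial_of_hasDerivWithinAt_nonpos
      (fun t ht => ((hE t ht).mul
        (((hξ t ht).add_const lam).sub ((hη t ht).const_mul (lam / γ)))).mul (hexp t))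
      (fun t _ => le_of_eq (by
        simp only [Pi.mul_apply, Pi.sub_apply]
        rw [hk']
        field_simp
        ring)) ht
    simp only [Pi.mul_apply, Pi.sub_apply, hE0, mul_zero, Real.exp_zero, one_mul,
      inv_one, mul_one, Real.exp_neg] at this
    rwa [← div_eq_mul_inv, div_le_iff₀ (Real.exp_pos _)] at this
  set c := p₀ + lam / γ * η 0
  have hEbound : ∀ t, 0 ≤ t → E t ≤ 1 + c * t + p₀ * (lam - ν) / 2 * t ^ 2 := fun t ht => by
    have hquad : ∀ t : ℝ, HasDerivWithinAt (fun t => c * t + p₀ * (lam - ν) / 2 * t ^ 2)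
        (c + p₀ * (lam - ν) * t) (Set.Ici 0) t := fun t => by
      refine (((hasDerivAt_id t).const_mul c).add
        ((hasDerivAt_pow 2 t).const_mul (p₀ * (lam - ν) / 2))).hasDerivWithinAt.congr_deriv ?_
      norm_num
      ring
    have := le_initial_of_hasDerivWithinAt_nonpos (fun t ht => (hE t ht).sub (hquad t))
      (fun t ht => by
        have h1 := hp t ht
        have h2 := mul_le_mul_of_nonneg_left (hηE t ht) (div_nonneg hlam0 hγ.le)
        have h3 := mul_le_mul_of_nonpos_left (Real.add_one_le_exp ((lam - ν) * t)) hp₀neg.le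
        have h4 := mul_nonneg hlam0 (hEpos t).le
        linarith) ht
    simp only [Pi.sub_apply, hE0] at this
    linarith
  have hd : p₀ * (lam - ν) / 2 < 0 := by
    have := mul_neg_of_neg_of_pos hp₀neg hμ
    linarith
  set d := p₀ * (lam - ν) / 2
  -- at `T = 1 + (|c| + 1) / (-d)` the quadratic bound is negative
  obtain ⟨T, hT1, hT⟩ : ∃ T : ℝ, 1 ≤ T ∧ |c| + 1 + d * T ≤ 0 := by
    refine ⟨1 + (|c| + 1) / (-d), le_add_of_nonneg_right (by
      have := neg_pos.2 hd
      positivity), ?_⟩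
    have : d * ((|c| + 1) / (-d)) = -(|c| + 1) := by
      field_simp [hd.ne]
    linarith
  have h1 := hEbound T (by linarith)
  have h2 := hEpos T
  nlinarith [mul_le_mul_of_nonneg_right (le_abs_self c) (by linarith : (0 : ℝ) ≤ T),
    mul_nonneg (by linarith : (0 : ℝ) ≤ T) (by linarith : 0 ≤ -(|c| + 1 + d * T))]
end

section
/- Let k < 0, ν ≥ 0, γ > 0, and λ = (ν + √(ν² - 4kγ))/2. Let r, s : [0, ∞) → ℝ be differentiable with r'(t) = -ν r(t) + k - kγ s(t) and s'(t) = r(t) for all t ≥ 0. If s(0) > 0 and γ r(0) ≥ λ(1 - γ s(0)), then for all t ≥ 0 one has s(t) > 0 and γ r(t) ≥ λ(1 - γ s(t)); that is, the region Σ_γ = {(r, s) : γ r ≥ λ(1 - γ s), s > 0} is invariant for this linear system. -/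
/-- Gronwall-type lower bound: `f' ≥ c f` on `[0, ∞)` implies `f 0 * exp (c t) ≤ f t`. -/
theorem mul_exp_le_of_mul_le_hasDerivWithinAt {f f' : ℝ → ℝ} {c : ℝ}
    (hf : ∀ t : ℝ, 0 ≤ t → HasDerivWithinAt f (f' t) (Set.Ici (0 : ℝ)) t)
    (hc : ∀ t : ℝ, 0 ≤ t → c * f t ≤ f' t) {t : ℝ} (ht : 0 ≤ t) :
    f 0 * Real.exp (c * t) ≤ f t := by
  have hderiv : ∀ x : ℝ, 0 ≤ x → HasDerivWithinAt (fun x => f x * Real.exp (-c * x))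
      (f' x * Real.exp (-c * x) + f x * (Real.exp (-c * x) * (-c * 1))) (Set.Ici (0 : ℝ)) x :=
    fun x hx => (hf x hx).mul (((hasDerivAt_id x).const_mul (-c)).exp.hasDerivWithinAt)
  have hmono : MonotoneOn (fun x => f x * Real.exp (-c * x)) (Set.Ici (0 : ℝ)) := by
    refine monotoneOn_of_hasDerivWithinAt_nonneg (convex_Ici 0)
      (fun x hx => (hderiv x hx).continuousWithinAt)
      (fun x hx => (hderiv x (interior_subset hx)).mono interior_subset) fun x hx => ?_
    have h := mul_nonneg (sub_nonneg.2 (hc x (interior_subset hx))) (Real.exp_pos (-c * x)).le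
    linarith
  have h := hmono Set.self_mem_Ici ht ht
  simp only [mul_zero, Real.exp_zero, mul_one] at h
  calc f 0 * Real.exp (c * t) ≤ f t * Real.exp (-c * t) * Real.exp (c * t) := by gcongr
    _ = f t := by rw [mul_assoc, ← Real.exp_add]; simp

/-- invariance of the region `Σ_γ = {(r,s) : γr ≥ λ(1 - γs), s > 0}`
for the linear system `r' = -νr + k - kγs`, `s' = r` on `[0, ∞)`. -/
theorem linear_system_invariant_region
    (k ν γ : ℝ) (hk : k < 0) (hν : 0 ≤ ν) (hγ : 0 < γ)
    (lam : ℝ)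
    (hlam : lam = (ν + Real.sqrt (ν ^ 2 - 4 * k * γ)) / 2)
    (r s : ℝ → ℝ)
    (hoder : ∀ t : ℝ, 0 ≤ t →
      HasDerivWithinAt r (-ν * r t + k - k * γ * s t) (Set.Ici (0 : ℝ)) t)
    (hodes : ∀ t : ℝ, 0 ≤ t →
      HasDerivWithinAt s (r t) (Set.Ici (0 : ℝ)) t)
    (hs0 : 0 < s 0)
    (hr0 : lam * (1 - γ * s 0) ≤ γ * r 0) :
    ∀ t : ℝ, 0 ≤ t → 0 < s t ∧ lam * (1 - γ * s t) ≤ γ * r t := by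
  have hdisc : 0 ≤ ν ^ 2 - 4 * k * γ := by nlinarith [mul_pos (neg_pos.2 hk) hγ, sq_nonneg ν]
  have hlam_nonneg : 0 ≤ lam := by rw [hlam]; positivity
  have hchar : lam * (lam - ν) = -k * γ := by
    rw [hlam]
    linear_combination Real.sq_sqrt hdisc / 4
  have hr : ∀ t : ℝ, 0 ≤ t → lam * (1 - γ * s t) ≤ γ * r t := by
    intro t ht
    have h := mul_exp_le_of_mul_le_hasDerivWithinAt (c := lam - ν)
      (fun x hx => ((hoder x hx).const_mul γ).sub
        ((((hodes x hx).const_mul γ).const_sub 1).const_mul lam))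
      (fun x _ => le_of_eq (by
        simp only [Pi.sub_apply]
        linear_combination (γ * s x - 1) * hchar)) ht
    have h0 := mul_nonneg (sub_nonneg.2 hr0) (Real.exp_pos ((lam - ν) * t)).le
    exact sub_nonneg.1 (h0.trans h)
  refine fun t ht => ⟨?_, hr t ht⟩
  have h := mul_exp_le_of_mul_le_hasDerivWithinAt (c := -lam)
    (fun x hx => ((hodes x hx).const_mul γ).sub_const 1)
    (fun x hx => by linarith [hr x hx]) ht
  have hexp : Real.exp (-lam * t) ≤ 1 := Real.exp_le_one_iff.2 (by nlinarith)
  have hpos := mul_pos (mul_pos hγ hs0) (Real.exp_pos (-lam * t))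
  exact pos_of_mul_pos_right (a := γ) (by linarith) hγ.le
end

section
/- Let k < 0, ν ≥ 0, γ > 0, λ = (ν + √(ν² - 4kγ))/2 and μ = (-ν + √(ν² - 4kγ))/2. Let r, s : [0, ∞) → ℝ be differentiable with r'(t) = -ν r(t) + k - kγ s(t) and s'(t) = r(t) for all t ≥ 0. If s(0) > 0 and γ r(0) < λ(1 - γ s(0)) (equivalently s(0) - 1/γ + r(0)/λ < 0), then there exists a finite time t_c > 0 with s(t_c) = 0, and moreover t_c ≤ (1/μ) ln( ((λ+μ)/λ) · (s(0) + 2/γ + |r(0)|/μ) / |s(0) - 1/γ + r(0)/λ| ). -/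
/-- A solution of `f' = c f` on `[0, ∞)` is exponential. -/
theorem eq_mul_exp_of_hasDerivWithinAt_Ici {f : ℝ → ℝ} {c : ℝ}
    (hf : ∀ t : ℝ, 0 ≤ t → HasDerivWithinAt f (c * f t) (Set.Ici 0) t) {t : ℝ} (ht : 0 ≤ t) :
    f t = f 0 * Real.exp (c * t) := by
  have hderiv : ∀ x : ℝ, 0 ≤ x →
      HasDerivWithinAt (fun x => f x * Real.exp (-c * x)) 0 (Set.Ici 0) x := by
    intro x hx
    have hexp : HasDerivAt (fun x => Real.exp (-c * x)) (Real.exp (-c * x) * (-c * 1)) x :=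
      ((hasDerivAt_id x).const_mul (-c)).exp
    exact ((hf x hx).mul hexp.hasDerivWithinAt).congr_deriv (by ring)
  have hconst := constant_of_has_deriv_right_zero
    (fun x hx => (hderiv x hx.1).continuousWithinAt.mono Set.Icc_subset_Ici_self)
    (fun x hx => (hderiv x hx.1).mono (Set.Ici_subset_Ici.2 hx.1)) t ⟨ht, le_rfl⟩
  simp only [mul_zero, Real.exp_zero, mul_one] at hconst
  rw [← hconst, mul_assoc, ← Real.exp_add]
  simp


/-- supercritical data for the linear system
`r' = -νr + k - kγs`, `s' = r` lead to `s` touching zero in finite time,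
with an explicit upper bound on the touching time. -/
theorem linear_system_finite_time_crossing
    (k ν γ : ℝ) (hk : k < 0) (hν : 0 ≤ ν) (hγ : 0 < γ)
    (lam mu : ℝ)
    (hlam : lam = (ν + Real.sqrt (ν ^ 2 - 4 * k * γ)) / 2)
    (hmu : mu = (-ν + Real.sqrt (ν ^ 2 - 4 * k * γ)) / 2)
    (r s : ℝ → ℝ)
    (hoder : ∀ t : ℝ, 0 ≤ t →
      HasDerivWithinAt r (-ν * r t + k - k * γ * s t) (Set.Ici (0 : ℝ)) t)
    (hodes : ∀ t : ℝ, 0 ≤ t →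
      HasDerivWithinAt s (r t) (Set.Ici (0 : ℝ)) t)
    (hs0 : 0 < s 0)
    (hr0 : γ * r 0 < lam * (1 - γ * s 0)) :
    ∃ tc : ℝ, 0 < tc ∧ s tc = 0 ∧
      tc ≤ (1 / mu) * Real.log (((lam + mu) / lam) *
        ((s 0 + 2 / γ + |r 0| / mu) / |s 0 - 1 / γ + r 0 / lam|)) := by
  set q := Real.sqrt (ν ^ 2 - 4 * k * γ) with hq
  have hkγ : 0 < -k * γ := mul_pos (neg_pos.2 hk) hγ
  have hq2 : q ^ 2 = ν ^ 2 - 4 * k * γ := Real.sq_sqrt (by nlinarith [sq_nonneg ν])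
  have hνq : ν < q := Real.lt_sqrt_of_sq_lt (by linarith)
  have hlam0 : 0 < lam := by linarith
  have hmu0 : 0 < mu := by linarith
  have hν_eq : ν = lam - mu := by rw [hlam, hmu]; ring
  have hprod : lam * mu = -k * γ := by rw [hlam, hmu]; linarith
  have hγinv : γ * (1 / γ) = 1 := mul_one_div_cancel hγ.ne'
  have hk_eq : k = -(lam * mu) * (1 / γ) := by rw [hprod]; linear_combination -k * hγinv
  clear_value q
  set g := 1 / γ with hg
  have hg0 : 0 < g := one_div_pos.2 hγ
  have hw : ∀ t : ℝ, 0 ≤ t → HasDerivWithinAt (fun t => s t - g) (r t) (Set.Ici 0) t :=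
    fun t ht => (hodes t ht).sub_const g
  have hgrow : ∀ t : ℝ, 0 ≤ t → r t + lam * (s t - g) =
      (r 0 + lam * (s 0 - g)) * Real.exp (mu * t) := fun t ht =>
    eq_mul_exp_of_hasDerivWithinAt_Ici (f := fun t => r t + lam * (s t - g))
      (fun t ht => ((hoder t ht).add ((hw t ht).const_mul lam)).congr_deriv (by
        rw [hν_eq]; linear_combination hk_eq - s t * hprod)) ht
  have hdecay : ∀ t : ℝ, 0 ≤ t → r t - mu * (s t - g) =
      (r 0 - mu * (s 0 - g)) * Real.exp (-lam * t) := fun t ht =>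
    eq_mul_exp_of_hasDerivWithinAt_Ici (f := fun t => r t - mu * (s t - g))
      (fun t ht => ((hoder t ht).sub ((hw t ht).const_mul mu)).congr_deriv (by
        rw [hν_eq]; linear_combination hk_eq - s t * hprod)) ht
  have hA : r 0 + lam * (s 0 - g) < 0 := by
    have h : γ * (r 0 + lam * (s 0 - g)) < 0 := by linear_combination hr0 - lam * hγinv
    exact (pos_iff_neg_of_mul_neg h).1 hγ
  have hD : lam * |s 0 - g + r 0 / lam| = -(r 0 + lam * (s 0 - g)) := by
    rw [← abs_of_pos hlam0, ← abs_mul, abs_of_pos hlam0, ← abs_of_neg hA]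
    congr 1
    field_simp
    ring
  have hD0 : 0 < |s 0 - g + r 0 / lam| := by
    refine pos_of_mul_pos_right ?_ hlam0.le
    rw [hD]
    linarith
  have hr_abs := neg_abs_le (r 0)
  have hr_abs' := le_abs_self (r 0)
  have hr_nonneg := abs_nonneg (r 0)
  have h2g : 2 / γ = 2 * g := by rw [hg]; ring
  rw [h2g]
  set D := |s 0 - g + r 0 / lam|
  set R := |r 0| / mu with hR
  have hR0 : 0 ≤ R := by positivity
  have hmuR : mu * R = |r 0| := mul_div_cancel₀ _ hmu0.ne'
  set X := (lam + mu) / lam * ((s 0 + 2 * g + R) / D) with hX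
  have hlamX : lam * D * X = (lam + mu) * (s 0 + 2 * g + R) := by
    rw [hX]; field_simp
  have hlamR := mul_nonneg hlam0.le hR0
  have hlams := mul_pos hlam0 hs0
  have hmus := mul_pos hmu0 hs0
  have hlamg := mul_pos hlam0 hg0
  have hmug := mul_pos hmu0 hg0
  have hX1 : 1 < X := by
    refine lt_of_mul_lt_mul_left (a := lam * D) ?_ (by positivity)
    rw [hlamX, hD]
    linarith
  set T := 1 / mu * Real.log X with hT
  have hT0 : 0 < T := mul_pos (one_div_pos.2 hmu0) (Real.log_pos hX1)
  have hexpT : Real.exp (mu * T) = X := by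
    rw [hT, ← mul_assoc, mul_one_div_cancel hmu0.ne', one_mul, Real.exp_log (by linarith)]
  have hsT : s T ≤ 0 := by
    have h₁ := hgrow T hT0.le
    have h₂ := hdecay T hT0.le
    rw [hexpT] at h₁
    have hexp_le : Real.exp (-lam * T) ≤ 1 :=
      Real.exp_le_one_iff.2 (by linarith [mul_pos hlam0 hT0])
    have hB : -(r 0 - mu * (s 0 - g)) * Real.exp (-lam * T) ≤ |r 0| + mu * (s 0 + g) :=
      calc -(r 0 - mu * (s 0 - g)) * Real.exp (-lam * T)
          ≤ (|r 0| + mu * (s 0 + g)) * Real.exp (-lam * T) :=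
            mul_le_mul_of_nonneg_right (by linarith) (Real.exp_pos _).le
        _ ≤ |r 0| + mu * (s 0 + g) := mul_le_of_le_one_right (by positivity) hexp_le
    rw [hD] at hlamX
    have h : (lam + mu) * s T ≤ 0 := by linarith
    exact nonpos_of_mul_nonpos_right h (by positivity)
  have hcont : ContinuousOn s (Set.Icc 0 T) := fun t ht =>
    (hodes t ht.1).continuousWithinAt.mono Set.Icc_subset_Ici_self
  obtain ⟨tc, htc, hstc⟩ := intermediate_value_Icc' hT0.le hcont ⟨hsT, hs0.le⟩
  refine ⟨tc, htc.1.lt_of_ne ?_, hstc, htc.2⟩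
  rintro rfl
  exact hs0.ne' hstc
end

section
/- (Comparison lemma, part i) Let k < 0, ν ≥ 0, γ > 0, and let c : [0, ∞) → ℝ be continuous with c(t) ≥ γ for all t. Let T ∈ (0, ∞] and let ρ, d, η, ξ : [0, T) → ℝ be differentiable with ρ' = -ρ d, d' = -d² - ν d + k(ρ - c(t)), η' = -η ξ, and ξ' = -ξ² - ν ξ + k η - kγ on [0, T). If 0 ≤ ρ(0) < η(0) and d(0) > ξ(0), then ρ(t) < η(t) and d(t) > ξ(t) for all t ∈ [0, T). -/
open Set

/-- If `f' + M f ≥ 0` on `(a, b)`, then `exp (M t) * f t` does not decrease from `a` to `b`. -/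
theorem exp_mul_le_exp_mul_of_deriv_add_mul_nonneg {f f' : ℝ → ℝ} {a b M : ℝ} (hab : a ≤ b)
    (hf : ∀ x ∈ Icc a b, HasDerivWithinAt f (f' x) (Icc a b) x)
    (hM : ∀ x ∈ Ioo a b, 0 ≤ f' x + M * f x) :
    Real.exp (M * a) * f a ≤ Real.exp (M * b) * f b := by
  have hmono : MonotoneOn (fun x => Real.exp (M * x) * f x) (Icc a b) := by
    apply monotoneOn_of_hasDerivWithinAt_nonneg (convex_Icc a b)
      (f' := fun x => Real.exp (M * x) * (f' x + M * f x))
    · exact (by fun_prop : Continuous fun x => Real.exp (M * x)).continuousOn.mul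
        fun x hx => (hf x hx).continuousWithinAt
    · intro x hx
      have hexp : HasDerivAt (fun y => Real.exp (M * y)) (Real.exp (M * x) * (M * 1)) x :=
        ((hasDerivAt_id x).const_mul M).exp
      refine (hexp.hasDerivWithinAt.mul
        ((hf x (interior_subset hx)).mono interior_subset)).congr_deriv ?_
      ring
    · intro x hx
      rw [interior_Icc] at hx
      exact mul_nonneg (Real.exp_pos _).le (hM x hx)
  exact hmono (left_mem_Icc.2 hab) (right_mem_Icc.2 hab) hab

/-- A continuous function on `[a, b]` is bounded in absolute value. -/
theorem exists_abs_le_of_continuousOn_Icc {f : ℝ → ℝ} {a b : ℝ} (hf : ContinuousOn f (Icc a b)) :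
    ∃ M, ∀ x ∈ Icc a b, |f x| ≤ M :=
  isCompact_Icc.exists_bound_of_continuousOn hf

/-- A solution of `f' = -f g` with nonnegative initial value stays nonnegative. -/
theorem nonneg_of_hasDerivWithinAt_neg_mul {f g : ℝ → ℝ} {a b : ℝ} (hab : a ≤ b)
    (hg : ContinuousOn g (Icc a b))
    (hf : ∀ x ∈ Icc a b, HasDerivWithinAt f (-(f x) * g x) (Icc a b) x) (ha : 0 ≤ f a) :
    0 ≤ f b := by
  by_contra! hb
  obtain ⟨M, hM⟩ := exists_abs_le_of_continuousOn_Icc hg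
  have hfc : ContinuousOn f (Icc a b) := fun x hx => (hf x hx).continuousWithinAt
  have hcomp : IsCompact (Icc a b ∩ f ⁻¹' Ici 0) :=
    isCompact_Icc.of_isClosed_subset (hfc.preimage_isClosed_of_isClosed isClosed_Icc isClosed_Ici)
      inter_subset_left
  obtain ⟨u, ⟨hu, hfu⟩, hmax⟩ := hcomp.exists_isGreatest ⟨a, left_mem_Icc.2 hab, ha⟩
  have hle := exp_mul_le_exp_mul_of_deriv_add_mul_nonneg (M := -M) hu.2
    (fun x hx => (hf x ⟨hu.1.trans hx.1, hx.2⟩).mono (Icc_subset_Icc_left hu.1))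
    (fun x hx => by
      have hx' : x ∈ Icc a b := ⟨hu.1.trans hx.1.le, hx.2.le⟩
      have hneg : f x < 0 := by
        by_contra! h
        exact absurd (hmax ⟨hx', h⟩) (not_le.2 hx.1)
      have := neg_abs_le (g x)
      nlinarith [hM x hx'])
  exact absurd ((mul_nonneg (Real.exp_pos _).le hfu).trans hle)
    (not_le.2 (mul_neg_of_pos_of_neg (Real.exp_pos _) hb))

/-- Positivity is preserved by cooperative linear differential inequalities
`f' ≥ -p f` and `g' ≥ -q g`, each of which need only hold where `f` and `g` are positive. -/
theorem pos_and_pos_of_cooperative {f g f' g' p q : ℝ → ℝ} {a b : ℝ} (hab : a ≤ b)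
    (hp : ContinuousOn p (Icc a b)) (hq : ContinuousOn q (Icc a b))
    (hf : ∀ x ∈ Icc a b, HasDerivWithinAt f (f' x) (Icc a b) x)
    (hg : ∀ x ∈ Icc a b, HasDerivWithinAt g (g' x) (Icc a b) x)
    (hf' : ∀ x ∈ Icc a b, 0 < f x → 0 < g x → -(p x) * f x ≤ f' x)
    (hg' : ∀ x ∈ Icc a b, 0 < f x → 0 < g x → -(q x) * g x ≤ g' x)
    (hfa : 0 < f a) (hga : 0 < g a) : 0 < f b ∧ 0 < g b := by
  by_contra hb
  obtain ⟨P, hP⟩ := exists_abs_le_of_continuousOn_Icc hp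
  obtain ⟨Q, hQ⟩ := exists_abs_le_of_continuousOn_Icc hq
  have hfc : ContinuousOn f (Icc a b) := fun x hx => (hf x hx).continuousWithinAt
  have hgc : ContinuousOn g (Icc a b) := fun x hx => (hg x hx).continuousWithinAt
  have hcomp : IsCompact (Icc a b ∩ (fun x => min (f x) (g x)) ⁻¹' Iic 0) :=
    isCompact_Icc.of_isClosed_subset
      ((hfc.inf hgc).preimage_isClosed_of_isClosed isClosed_Icc isClosed_Iic) inter_subset_left
  obtain ⟨u, ⟨hu, hfgu⟩, hmin⟩ := hcomp.exists_isLeast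
    ⟨b, right_mem_Icc.2 hab, not_lt.1 fun h => hb (lt_min_iff.1 h)⟩
  have hpos : ∀ x ∈ Ioo a u, x ∈ Icc a b ∧ 0 < f x ∧ 0 < g x := fun x hx => by
    have hx' : x ∈ Icc a b := ⟨hx.1.le, hx.2.le.trans hu.2⟩
    refine ⟨hx', lt_min_iff.1 ?_⟩
    by_contra! h
    exact absurd (hmin ⟨hx', h⟩) (not_le.2 hx.2)
  have hsub : Icc a u ⊆ Icc a b := Icc_subset_Icc_right hu.2
  have hfu := exp_mul_le_exp_mul_of_deriv_add_mul_nonneg (M := P) hu.1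
    (fun x hx => (hf x (hsub hx)).mono hsub)
    (fun x hx => by
      obtain ⟨hx', hfx, hgx⟩ := hpos x hx
      nlinarith [hf' x hx' hfx hgx, hP x hx', le_abs_self (p x)])
  have hgu := exp_mul_le_exp_mul_of_deriv_add_mul_nonneg (M := Q) hu.1
    (fun x hx => (hg x (hsub hx)).mono hsub)
    (fun x hx => by
      obtain ⟨hx', hfx, hgx⟩ := hpos x hx
      nlinarith [hg' x hx' hfx hgx, hQ x hx', le_abs_self (q x)])
  have hmin_nonpos : min (f u) (g u) ≤ 0 := hfgu
  refine absurd hmin_nonpos (not_le.2 (lt_min ?_ ?_))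
  · exact pos_of_mul_pos_right ((mul_pos (Real.exp_pos _) hfa).trans_le hfu) (Real.exp_pos _).le
  · exact pos_of_mul_pos_right ((mul_pos (Real.exp_pos _) hga).trans_le hgu) (Real.exp_pos _).le

/-- Comparison lemma, part i: with variable background `c(t) ≥ γ`,
if `0 ≤ ρ(0) < η(0)` and `d(0) > ξ(0)` then `ρ(t) < η(t)` and `d(t) > ξ(t)`
on `[0, T)`, where `(ρ, d)` solves the characteristic system and `(η, ξ)`
solves the auxiliary system with constant background `γ`. -/
theorem comparison_lemma_i
    (k ν γ : ℝ) (hk : k < 0) (hν : 0 ≤ ν) (hγ : 0 < γ)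
    (c : ℝ → ℝ) (hc_cont : Continuous c) (hc : ∀ t : ℝ, 0 ≤ t → γ ≤ c t)
    (T : EReal) (hT : 0 < T)
    (ρ d η ξ : ℝ → ℝ)
    (hodeρ : ∀ t : ℝ, 0 ≤ t → (t : EReal) < T →
      HasDerivWithinAt ρ (-(ρ t) * d t) {s : ℝ | 0 ≤ s ∧ (s : EReal) < T} t)
    (hoded : ∀ t : ℝ, 0 ≤ t → (t : EReal) < T →
      HasDerivWithinAt d (-(d t) ^ 2 - ν * d t + k * (ρ t - c t))
        {s : ℝ | 0 ≤ s ∧ (s : EReal) < T} t)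
    (hodeη : ∀ t : ℝ, 0 ≤ t → (t : EReal) < T →
      HasDerivWithinAt η (-(η t) * ξ t) {s : ℝ | 0 ≤ s ∧ (s : EReal) < T} t)
    (hodeξ : ∀ t : ℝ, 0 ≤ t → (t : EReal) < T →
      HasDerivWithinAt ξ (-(ξ t) ^ 2 - ν * ξ t + k * η t - k * γ)
        {s : ℝ | 0 ≤ s ∧ (s : EReal) < T} t)
    (hρ0 : 0 ≤ ρ 0) (hρη0 : ρ 0 < η 0) (hdξ0 : ξ 0 < d 0) :
    ∀ t : ℝ, 0 ≤ t → (t : EReal) < T → ρ t < η t ∧ ξ t < d t := by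
  intro t ht htT
  have hsub : Icc 0 t ⊆ {s : ℝ | 0 ≤ s ∧ (s : EReal) < T} := fun s hs =>
    ⟨hs.1, (EReal.coe_le_coe_iff.2 hs.2).trans_lt htT⟩
  have hρ : ∀ s ∈ Icc 0 t, HasDerivWithinAt ρ (-(ρ s) * d s) (Icc 0 t) s := fun s hs =>
    (hodeρ s (hsub hs).1 (hsub hs).2).mono hsub
  have hd : ∀ s ∈ Icc 0 t, HasDerivWithinAt d _ (Icc 0 t) s := fun s hs =>
    (hoded s (hsub hs).1 (hsub hs).2).mono hsub
  have hη : ∀ s ∈ Icc 0 t, HasDerivWithinAt η _ (Icc 0 t) s := fun s hs =>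
    (hodeη s (hsub hs).1 (hsub hs).2).mono hsub
  have hξ : ∀ s ∈ Icc 0 t, HasDerivWithinAt ξ _ (Icc 0 t) s := fun s hs =>
    (hodeξ s (hsub hs).1 (hsub hs).2).mono hsub
  have hdc : ContinuousOn d (Icc 0 t) := fun s hs => (hd s hs).continuousWithinAt
  have hξc : ContinuousOn ξ (Icc 0 t) := fun s hs => (hξ s hs).continuousWithinAt
  have hρ_nonneg : ∀ s ∈ Icc 0 t, 0 ≤ ρ s := fun s hs => by
    have hst : Icc 0 s ⊆ Icc 0 t := Icc_subset_Icc_right hs.2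
    exact nonneg_of_hasDerivWithinAt_neg_mul hs.1 (hdc.mono hst)
      (fun x hx => (hρ x (hst hx)).mono hst) hρ0
  have key := pos_and_pos_of_cooperative (p := ξ) (q := fun s => d s + ξ s + ν) ht hξc
    ((hdc.add hξc).add continuousOn_const)
    (fun s hs => (hη s hs).sub (hρ s hs)) (fun s hs => (hd s hs).sub (hξ s hs))
    (fun s hs _ hds => by
      simp only [Pi.sub_apply] at hds ⊢
      nlinarith [mul_nonneg (hρ_nonneg s hs) hds.le])
    (fun s hs hηs _ => by
      simp only [Pi.sub_apply] at hηs ⊢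
      nlinarith [mul_pos (neg_pos.2 hk) hηs,
        mul_nonneg (neg_pos.2 hk).le (sub_nonneg.2 (hc s hs.1))])
    (sub_pos.2 hρη0) (sub_pos.2 hdξ0)
  exact ⟨sub_pos.1 key.1, sub_pos.1 key.2⟩
end

section
/- (Comparison lemma, part ii) Let k < 0, ν ≥ 0, γ > 0, and let c : [0, ∞) → ℝ be continuous with c(t) ≤ γ for all t. Let T ∈ (0, ∞] and let ρ, d, η, ξ : [0, T) → ℝ be differentiable with ρ' = -ρ d, d' = -d² - ν d + k(ρ - c(t)), η' = -η ξ, and ξ' = -ξ² - ν ξ + k η - kγ on [0, T). If ρ(0) > η(0) ≥ 0 and d(0) < ξ(0), then ρ(t) > η(t) and d(t) < ξ(t) for all t ∈ [0, T). -/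
open Set in
/-- A function satisfying `a f ≤ f'` on `(0, b)` dominates at `b` a positive multiple of its
initial value. -/
theorem exists_pos_mul_le_of_mul_le_deriv {b : ℝ} (hb : 0 ≤ b) {a f f' : ℝ → ℝ}
    (ha : ContinuousOn a (Icc 0 b)) (hf : ContinuousOn f (Icc 0 b))
    (hf' : ∀ s ∈ Ioo 0 b, HasDerivAt f (f' s) s)
    (hle : ∀ s ∈ Ioo 0 b, a s * f s ≤ f' s) :
    ∃ C : ℝ, 0 < C ∧ C * f 0 ≤ f b := by
  set e : ℝ → ℝ := IccExtend hb ((Icc 0 b).domRestrict a) with he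
  have hec : Continuous e := (continuousOn_iff_continuous_domRestrict.1 ha).Icc_extend'
  have heq : ∀ s ∈ Icc 0 b, e s = a s := fun s hs => by
    rw [he, IccExtend_of_mem hb _ hs, domRestrict_apply]
  set A : ℝ → ℝ := fun x => ∫ y in (0 : ℝ)..x, e y with hA
  have hAd : ∀ x, HasDerivAt A (e x) x := fun x => hec.integral_hasStrictDerivAt 0 x |>.hasDerivAt
  have hAc : Continuous A := continuous_iff_continuousAt.2 fun x => (hAd x).continuousAt
  have hmono : MonotoneOn (fun x => f x * Real.exp (-A x)) (Icc 0 b) := by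
    have hderiv : ∀ s ∈ Ioo 0 b, HasDerivAt (fun x => f x * Real.exp (-A x))
        (f' s * Real.exp (-A s) + f s * (Real.exp (-A s) * -e s)) s := fun s hs =>
      (hf' s hs).mul (hAd s).neg.exp
    refine monotoneOn_of_deriv_nonneg (convex_Icc 0 b) (hf.mul (by fun_prop)) ?_ ?_
    · rw [interior_Icc]
      exact fun s hs => (hderiv s hs).differentiableAt.differentiableWithinAt
    · rw [interior_Icc]
      intro s hs
      rw [(hderiv s hs).deriv, heq s (Ioo_subset_Icc_self hs)]
      have := mul_nonneg (sub_nonneg.2 (hle s hs)) (Real.exp_pos (-A s)).le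
      linarith
  have h := hmono (left_mem_Icc.2 hb) (right_mem_Icc.2 hb) hb
  have hA0 : A 0 = 0 := by simp [hA]
  simp only [hA0, neg_zero, Real.exp_zero, mul_one] at h
  refine ⟨Real.exp (A b), Real.exp_pos _, ?_⟩
  calc Real.exp (A b) * f 0 ≤ Real.exp (A b) * (f b * Real.exp (-A b)) := by gcongr
    _ = f b := by rw [mul_left_comm, ← Real.exp_add, add_neg_cancel, Real.exp_zero, mul_one]

open Set in
/-- Two continuous functions, positive at `0`, stay positive on `[0, b]` if at every `s` both are
positive as soon as they are positive on `[0, s)`. -/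
theorem pos_of_forall_pos_before {b : ℝ} (hb : 0 ≤ b) {u v : ℝ → ℝ}
    (hu : ContinuousOn u (Icc 0 b)) (hv : ContinuousOn v (Icc 0 b))
    (step : ∀ s ∈ Icc 0 b, (∀ r ∈ Ico 0 s, 0 < u r ∧ 0 < v r) → 0 < u s ∧ 0 < v s) :
    0 < u b ∧ 0 < v b := by
  by_contra hcon
  set S : Set ℝ := Icc 0 b ∩ (fun x => min (u x) (v x)) ⁻¹' Iic 0 with hS
  have hSc : IsCompact S :=
    isCompact_Icc.of_isClosed_subset
      ((hu.inf hv).preimage_isClosed_of_isClosed isClosed_Icc isClosed_Iic) inter_subset_left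
  have hbS : b ∈ S := ⟨right_mem_Icc.2 hb, by
    by_contra h
    exact hcon (lt_min_iff.1 (not_le.1 h))⟩
  obtain ⟨s, hs, hmin⟩ := hSc.exists_isLeast ⟨b, hbS⟩
  refine absurd hs.2 (not_le.2 (lt_min_iff.2 (step s hs.1 fun r hr => ?_)))
  by_contra h
  refine absurd (hmin ⟨⟨hr.1, hr.2.le.trans hs.1.2⟩, ?_⟩) (not_le.2 hr.2)
  exact not_lt.1 fun h' => h (lt_min_iff.1 h')


/-- Comparison lemma, part ii: with variable background `c(t) ≤ γ`,
if `ρ(0) > η(0) ≥ 0` and `d(0) < ξ(0)` then `ρ(t) > η(t)` and `d(t) < ξ(t)`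
on `[0, T)`, where `(ρ, d)` solves the characteristic system and `(η, ξ)`
solves the auxiliary system with constant background `γ`. -/
theorem comparison_lemma_ii
    (k ν γ : ℝ) (hk : k < 0) (hν : 0 ≤ ν) (hγ : 0 < γ)
    (c : ℝ → ℝ) (hc_cont : Continuous c) (hc : ∀ t : ℝ, 0 ≤ t → c t ≤ γ)
    (T : EReal) (hT : 0 < T)
    (ρ d η ξ : ℝ → ℝ)
    (hodeρ : ∀ t : ℝ, 0 ≤ t → (t : EReal) < T →
      HasDerivWithinAt ρ (-(ρ t) * d t) {s : ℝ | 0 ≤ s ∧ (s : EReal) < T} t)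
    (hoded : ∀ t : ℝ, 0 ≤ t → (t : EReal) < T →
      HasDerivWithinAt d (-(d t) ^ 2 - ν * d t + k * (ρ t - c t))
        {s : ℝ | 0 ≤ s ∧ (s : EReal) < T} t)
    (hodeη : ∀ t : ℝ, 0 ≤ t → (t : EReal) < T →
      HasDerivWithinAt η (-(η t) * ξ t) {s : ℝ | 0 ≤ s ∧ (s : EReal) < T} t)
    (hodeξ : ∀ t : ℝ, 0 ≤ t → (t : EReal) < T →
      HasDerivWithinAt ξ (-(ξ t) ^ 2 - ν * ξ t + k * η t - k * γ)
        {s : ℝ | 0 ≤ s ∧ (s : EReal) < T} t)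
    (hη0 : 0 ≤ η 0) (hρη0 : η 0 < ρ 0) (hdξ0 : d 0 < ξ 0) :
    ∀ t : ℝ, 0 ≤ t → (t : EReal) < T → η t < ρ t ∧ d t < ξ t := by
  intro t ht htT
  have hlt : ∀ s ∈ Set.Icc 0 t, (s : EReal) < T := fun s hs =>
    (EReal.coe_le_coe_iff.2 hs.2).trans_lt htT
  have hsub : Set.Icc 0 t ⊆ {s : ℝ | 0 ≤ s ∧ (s : EReal) < T} := fun s hs => ⟨hs.1, hlt s hs⟩
  have hcont : ∀ {f f' : ℝ → ℝ}, (∀ s : ℝ, 0 ≤ s → (s : EReal) < T →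
      HasDerivWithinAt f (f' s) {s : ℝ | 0 ≤ s ∧ (s : EReal) < T} s) →
      ContinuousOn f (Set.Icc 0 t) := fun h s hs =>
    ((h s hs.1 (hlt s hs)).mono hsub).continuousWithinAt
  have hderiv : ∀ {f f' : ℝ → ℝ}, (∀ s : ℝ, 0 ≤ s → (s : EReal) < T →
      HasDerivWithinAt f (f' s) {s : ℝ | 0 ≤ s ∧ (s : EReal) < T} s) →
      ∀ s ∈ Set.Ioo 0 t, HasDerivAt f (f' s) s := fun h s hs =>
    ((h s hs.1.le (hlt s (Set.Ioo_subset_Icc_self hs))).mono hsub).hasDerivAt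
      (Icc_mem_nhds hs.1 hs.2)
  have cρ := hcont hodeρ
  have cd := hcont hoded
  have cη := hcont hodeη
  have cξ := hcont hodeξ
  have dρ := hderiv hodeρ
  have dd := hderiv hoded
  have dη := hderiv hodeη
  have dξ := hderiv hodeξ
  have hη : ∀ s ∈ Set.Icc 0 t, 0 ≤ η s := by
    intro s hs
    have hss : Set.Icc 0 s ⊆ Set.Icc 0 t := Set.Icc_subset_Icc_right hs.2
    obtain ⟨C, hC, h⟩ := exists_pos_mul_le_of_mul_le_deriv hs.1 (cξ.mono hss).neg (cη.mono hss)
      (fun r hr => dη r ⟨hr.1, hr.2.trans_le hs.2⟩)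
      (fun r _ => le_of_eq (by simp only [Pi.neg_apply]; ring))
    exact (mul_nonneg hC.le hη0).trans h
  have key := pos_of_forall_pos_before ht (cρ.sub cη) (cξ.sub cd) ?_
  · exact ⟨sub_pos.1 key.1, sub_pos.1 key.2⟩
  intro s hs hpos
  have hss : Set.Icc 0 s ⊆ Set.Icc 0 t := Set.Icc_subset_Icc_right hs.2
  have hmem : ∀ r ∈ Set.Ioo 0 s, r ∈ Set.Ioo 0 t := fun r hr => ⟨hr.1, hr.2.trans_le hs.2⟩
  obtain ⟨C, hC, hu⟩ := exists_pos_mul_le_of_mul_le_deriv hs.1 (cd.mono hss).neg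
    ((cρ.sub cη).mono hss) (fun r hr => (dρ r (hmem r hr)).sub (dη r (hmem r hr)))
    (fun r hr => by
      have h1 := (hpos r ⟨hr.1.le, hr.2⟩).2
      have h2 := mul_nonneg (hη r (Set.Ioo_subset_Icc_self (hmem r hr))) h1.le
      simp only [Pi.neg_apply, Pi.sub_apply] at h2 ⊢
      linarith)
  obtain ⟨C', hC', hv⟩ := exists_pos_mul_le_of_mul_le_deriv hs.1
    (a := fun r => -(ξ r + d r + ν))
    (((cξ.add cd).add continuousOn_const).neg.mono hss)
    ((cξ.sub cd).mono hss) (fun r hr => (dξ r (hmem r hr)).sub (dd r (hmem r hr)))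
    (fun r hr => by
      have h1 := (hpos r ⟨hr.1.le, hr.2⟩).1
      have h2 := mul_nonneg (neg_nonneg.2 hk.le) h1.le
      have h3 := mul_nonneg (neg_nonneg.2 hk.le) (sub_nonneg.2 (hc r hr.1.le))
      simp only [Pi.sub_apply] at h2 ⊢
      linarith)
  exact ⟨(mul_pos hC (sub_pos.2 hρη0)).trans_le hu, (mul_pos hC' (sub_pos.2 hdξ0)).trans_le hv⟩
end

section
/- (Global regularity threshold along characteristics) Let k < 0, ν ≥ 0 and 0 < c₁ ≤ c₂, and let c : [0, ∞) → ℝ be continuous with c₁ ≤ c(t) ≤ c₂ for all t. Set λ₁ = (ν + √(ν² - 4kc₁))/2 and Θ₂ = (-ν + √(ν² - 4kc₂))/2. Let T ∈ (0, ∞] and let ρ, d : [0, T) → ℝ be differentiable with ρ' = -ρ d and d' = -d² - ν d + k(ρ - c(t)) on [0, T). If ρ(0) ≥ 0 and d(0) > (λ₁/c₁)(ρ(0) - c₁), then for all t ∈ [0, T): 0 ≤ ρ(t) ≤ ρ(0) e^{λ₁ t} and -λ₁ ≤ d(t) ≤ max{d(0), Θ₂}. -/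
/-- A function with `f' ≥ a f` on `[0, t]`, `a` continuous, stays nonnegative if it starts so. -/
lemma nonneg_of_linear_differential_inequality {f f' a : ℝ → ℝ} {t : ℝ} (ht : 0 ≤ t)
    (ha : ContinuousOn a (Set.Icc 0 t))
    (hf : ∀ s ∈ Set.Icc 0 t, HasDerivWithinAt f (f' s) (Set.Icc 0 t) s)
    (hle : ∀ s ∈ Set.Icc 0 t, a s * f s ≤ f' s) (h0 : 0 ≤ f 0) :
    ∀ s ∈ Set.Icc 0 t, 0 ≤ f s := by
  set b : ℝ → ℝ := Set.IccExtend ht ((Set.Icc 0 t).domRestrict a) with hb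
  have hbc : Continuous b := ha.domRestrict.Icc_extend'
  have hba : ∀ s ∈ Set.Icc 0 t, b s = a s := fun s hs => by
    rw [hb, Set.IccExtend_of_mem ht _ hs, Set.domRestrict_apply]
  set A : ℝ → ℝ := fun s => ∫ x in (0 : ℝ)..s, b x
  have hA : ∀ s, HasDerivAt A (b s) s := fun s => hbc.integral_hasStrictDerivAt 0 s |>.hasDerivAt
  have hg : ∀ s ∈ Set.Icc 0 t, HasDerivWithinAt (fun s => f s * Real.exp (-A s))
      (f' s * Real.exp (-A s) + f s * (Real.exp (-A s) * -b s)) (Set.Icc 0 t) s :=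
    fun s hs => (hf s hs).mul (hA s).neg.exp.hasDerivWithinAt
  have hmono : MonotoneOn (fun s => f s * Real.exp (-A s)) (Set.Icc 0 t) := by
    refine monotoneOn_of_hasDerivWithinAt_nonneg (convex_Icc 0 t)
      (fun s hs => (hg s hs).continuousWithinAt)
      (fun s hs => (hg s (interior_subset hs)).mono interior_subset) fun s hs => ?_
    have hs := interior_subset hs
    rw [hba s hs]
    have := mul_nonneg (sub_nonneg.2 (hle s hs)) (Real.exp_pos (-A s)).le
    linarith
  intro s hs
  have h := hmono (Set.left_mem_Icc.2 ht) hs hs.1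
  have h' : 0 ≤ f s * Real.exp (-A s) := (mul_nonneg h0 (Real.exp_pos _).le).trans h
  exact nonneg_of_mul_nonneg_left h' (Real.exp_pos _)

/-- The larger root `(p + √(p² + 4q)) / 2` of `x² - p x - q` is positive and is a root. -/
lemma half_add_sqrt_root {p q x : ℝ} (hq : 0 < q)
    (hx : x = (p + Real.sqrt (p ^ 2 + 4 * q)) / 2) : 0 < x ∧ x ^ 2 = p * x + q := by
  have hsq := Real.sq_sqrt (show 0 ≤ p ^ 2 + 4 * q by positivity)
  have hlt : |p| < Real.sqrt (p ^ 2 + 4 * q) := Real.lt_sqrt_of_sq_lt (by rw [sq_abs]; linarith)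
  have := neg_abs_le p
  refine ⟨by linarith, ?_⟩
  rw [hx]
  linarith


/-- Global regularity threshold along characteristics:
for the characteristic system `ρ' = -ρd`, `d' = -d² - νd + k(ρ - c(t))` with
`c₁ ≤ c(t) ≤ c₂`, subcritical data `ρ(0) ≥ 0`, `d(0) > (λ₁/c₁)(ρ(0) - c₁)`
give the a priori bounds `0 ≤ ρ(t) ≤ ρ(0)e^{λ₁t}` and `-λ₁ ≤ d(t) ≤ max{d(0), Θ₂}`. -/
theorem global_regularity_threshold
    (k ν c₁ c₂ : ℝ) (hk : k < 0) (hν : 0 ≤ ν) (hc₁ : 0 < c₁) (hc₁₂ : c₁ ≤ c₂)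
    (c : ℝ → ℝ) (hc_cont : Continuous c)
    (hc : ∀ t : ℝ, 0 ≤ t → c₁ ≤ c t ∧ c t ≤ c₂)
    (lam₁ Θ₂ : ℝ)
    (hlam₁ : lam₁ = (ν + Real.sqrt (ν ^ 2 - 4 * k * c₁)) / 2)
    (hΘ₂ : Θ₂ = (-ν + Real.sqrt (ν ^ 2 - 4 * k * c₂)) / 2)
    (T : EReal) (hT : 0 < T)
    (ρ d : ℝ → ℝ)
    (hodeρ : ∀ t : ℝ, 0 ≤ t → (t : EReal) < T →
      HasDerivWithinAt ρ (-(ρ t) * d t) {s : ℝ | 0 ≤ s ∧ (s : EReal) < T} t)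
    (hoded : ∀ t : ℝ, 0 ≤ t → (t : EReal) < T →
      HasDerivWithinAt d (-(d t) ^ 2 - ν * d t + k * (ρ t - c t))
        {s : ℝ | 0 ≤ s ∧ (s : EReal) < T} t)
    (hρ0 : 0 ≤ ρ 0)
    (hd0 : (lam₁ / c₁) * (ρ 0 - c₁) < d 0) :
    ∀ t : ℝ, 0 ≤ t → (t : EReal) < T →
      0 ≤ ρ t ∧ ρ t ≤ ρ 0 * Real.exp (lam₁ * t) ∧
      -lam₁ ≤ d t ∧ d t ≤ max (d 0) Θ₂ := by
  have hroot₁ := half_add_sqrt_root (p := ν) (q := -k * c₁) (x := lam₁)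
    (by nlinarith) (by rw [hlam₁]; ring_nf)
  have hroot₂ := half_add_sqrt_root (p := -ν) (q := -k * c₂) (x := Θ₂)
    (by nlinarith) (by rw [hΘ₂]; ring_nf)
  obtain ⟨hlpos, hlroot⟩ := hroot₁
  obtain ⟨hΘpos, hΘroot⟩ := hroot₂
  intro t ht htT
  have hsub : Set.Icc 0 t ⊆ {s : ℝ | 0 ≤ s ∧ (s : EReal) < T} := fun s hs =>
    ⟨hs.1, (EReal.coe_le_coe_iff.2 hs.2).trans_lt htT⟩
  have hρ : ∀ s ∈ Set.Icc 0 t, HasDerivWithinAt ρ (-(ρ s) * d s) (Set.Icc 0 t) s :=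
    fun s hs => (hodeρ s (hsub hs).1 (hsub hs).2).mono hsub
  have hd : ∀ s ∈ Set.Icc 0 t, HasDerivWithinAt d
      (-(d s) ^ 2 - ν * d s + k * (ρ s - c s)) (Set.Icc 0 t) s :=
    fun s hs => (hoded s (hsub hs).1 (hsub hs).2).mono hsub
  have hdc : ContinuousOn d (Set.Icc 0 t) := fun s hs => (hd s hs).continuousWithinAt
  have htmem : t ∈ Set.Icc 0 t := Set.right_mem_Icc.2 ht
  have hρnn : ∀ s ∈ Set.Icc 0 t, 0 ≤ ρ s :=
    nonneg_of_linear_differential_inequality ht hdc.neg hρ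
      (fun s _ => by simp only [Pi.neg_apply]; linarith) hρ0
  have hw : ∀ s ∈ Set.Icc 0 t, 0 ≤ d s - lam₁ / c₁ * (ρ s - c₁) := by
    refine nonneg_of_linear_differential_inequality (a := fun s => -(d s + k * c₁ / lam₁)) ht
      (hdc.add continuousOn_const).neg
      (fun s hs => (hd s hs).sub (((hρ s hs).sub_const c₁).const_mul (lam₁ / c₁)))
      (fun s hs => ?_) (by linarith)
    have hkc : k * c s ≤ k * c₁ := mul_le_mul_of_nonpos_left (hc s hs.1).1 hk.le
    have hν_eq : ν = lam₁ + k * c₁ / lam₁ := by field_simp; linarith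
    have hid : -(d s + k * c₁ / lam₁) * (d s - lam₁ / c₁ * (ρ s - c₁)) =
        -(d s) ^ 2 - ν * d s + k * (ρ s - c₁) - lam₁ / c₁ * (-(ρ s) * d s) := by
      rw [hν_eq]; field_simp; ring
    linarith
  have hdlow : ∀ s ∈ Set.Icc 0 t, -lam₁ ≤ d s := fun s hs => by
    have h₁ := hw s hs
    have h₂ : 0 ≤ lam₁ / c₁ * ρ s := mul_nonneg (by positivity) (hρnn s hs)
    have h₃ : lam₁ / c₁ * c₁ = lam₁ := by field_simp
    linarith
  have hρup : ∀ s ∈ Set.Icc 0 t, 0 ≤ ρ 0 * Real.exp (lam₁ * s) - ρ s := by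
    refine nonneg_of_linear_differential_inequality (a := fun _ => lam₁) ht continuousOn_const
      (fun s hs => (((((hasDerivAt_id s).const_mul lam₁).exp).const_mul
        (ρ 0)).hasDerivWithinAt).sub (hρ s hs))
      (fun s hs => ?_) (by simp)
    have := mul_nonneg (hρnn s hs) (neg_le_iff_add_nonneg.1 (hdlow s hs))
    simp only [id]
    linarith
  have hdup : ∀ s ∈ Set.Icc 0 t, 0 ≤ max (d 0) Θ₂ - d s := by
    have hΘM := le_max_right (d 0) Θ₂
    set M := max (d 0) Θ₂ with hM
    refine nonneg_of_linear_differential_inequality (a := fun s => -(d s + M + ν)) ht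
      ((hdc.add continuousOn_const).add continuousOn_const).neg
      (fun s hs => (hd s hs).const_sub M) (fun s hs => ?_) (sub_nonneg.2 (le_max_left _ _))
    have hkc : k * c₂ ≤ k * c s := mul_le_mul_of_nonpos_left (hc s hs.1).2 hk.le
    have hkρ : k * ρ s ≤ 0 := mul_nonpos_of_nonpos_of_nonneg hk.le (hρnn s hs)
    have hMroot : 0 ≤ (M - Θ₂) * (M + Θ₂ + ν) :=
      mul_nonneg (sub_nonneg.2 hΘM) (by linarith)
    linarith
  exact ⟨hρnn t htmem, sub_nonneg.1 (hρup t htmem), hdlow t htmem, sub_nonneg.1 (hdup t htmem)⟩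
end

section
/- Let k < 0, γ > 0, β ≥ 0, and set λ = (β + √(β² - 4kγ))/2 and μ = (-β + √(β² - 4kγ))/2. Let p, q : [0, ∞) → ℝ be differentiable with p'(t) = k - kγ q(t) and q'(t) = p(t) - β q(t) for all t ≥ 0. If q(0) > 0 and p(0) ≥ λ/γ - μ q(0), then for all t ≥ 0 one has q(t) > 0 and p(t) ≥ λ/γ - μ q(t); that is, the region Σ_{γ,β} = {(p, q) : p ≥ λ/γ - μ q, q > 0} is invariant. -/
/-- A one-sided Grönwall inequality: if `f' ≥ c f` on `[0, ∞)`, then `f t ≥ f 0 * exp (c t)`. -/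
theorem mul_exp_le_of_hasDerivWithinAt_ge {f f' : ℝ → ℝ} {c : ℝ}
    (hf : ∀ t : ℝ, 0 ≤ t → HasDerivWithinAt f (f' t) (Set.Ici (0 : ℝ)) t)
    (hle : ∀ t : ℝ, 0 ≤ t → c * f t ≤ f' t) {t : ℝ} (ht : 0 ≤ t) :
    f 0 * Real.exp (c * t) ≤ f t := by
  have hd : ∀ s : ℝ, 0 ≤ s → HasDerivWithinAt (fun x => f x * Real.exp (-c * x))
      (f' s * Real.exp (-c * s) + f s * (Real.exp (-c * s) * (-c))) (Set.Ici (0 : ℝ)) s := by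
    intro s hs
    have he : HasDerivAt (fun x : ℝ => Real.exp (-c * x)) (Real.exp (-c * s) * (-c)) s := by
      simpa using ((hasDerivAt_id s).const_mul (-c)).exp
    exact (hf s hs).mul he.hasDerivWithinAt
  have hmono : MonotoneOn (fun x => f x * Real.exp (-c * x)) (Set.Ici (0 : ℝ)) := by
    refine monotoneOn_of_hasDerivWithinAt_nonneg (convex_Ici 0)
      (fun s hs => (hd s hs).continuousWithinAt)
      (fun s hs => (hd s (interior_subset hs)).mono interior_subset) fun s hs => ?_
    have h := mul_nonneg (sub_nonneg.2 (hle s (interior_subset hs))) (Real.exp_pos (-c * s)).le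
    linarith
  have h := hmono Set.self_mem_Ici ht ht
  simp only [mul_zero, Real.exp_zero, mul_one] at h
  calc f 0 * Real.exp (c * t) ≤ f t * Real.exp (-c * t) * Real.exp (c * t) := by gcongr
    _ = f t := by rw [mul_assoc, ← Real.exp_add]; simp


/-- invariance of the region `Σ_{γ,β} = {(p,q) : p ≥ λ/γ - μq, q > 0}`
for the linear system `p' = k - kγq`, `q' = p - βq` on `[0, ∞)`. -/
theorem alignment_linear_invariant_region
    (k γ β : ℝ) (hk : k < 0) (hγ : 0 < γ) (hβ : 0 ≤ β)
    (lam mu : ℝ)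
    (hlam : lam = (β + Real.sqrt (β ^ 2 - 4 * k * γ)) / 2)
    (hmu : mu = (-β + Real.sqrt (β ^ 2 - 4 * k * γ)) / 2)
    (p q : ℝ → ℝ)
    (hodep : ∀ t : ℝ, 0 ≤ t →
      HasDerivWithinAt p (k - k * γ * q t) (Set.Ici (0 : ℝ)) t)
    (hodeq : ∀ t : ℝ, 0 ≤ t →
      HasDerivWithinAt q (p t - β * q t) (Set.Ici (0 : ℝ)) t)
    (hq0 : 0 < q 0)
    (hp0 : lam / γ - mu * q 0 ≤ p 0) :
    ∀ t : ℝ, 0 ≤ t → 0 < q t ∧ lam / γ - mu * q t ≤ p t := by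
  have hD : 0 ≤ β ^ 2 - 4 * k * γ := by nlinarith [mul_pos (neg_pos.2 hk) hγ, sq_nonneg β]
  have hsq := Real.sq_sqrt hD
  have hlam_nonneg : 0 ≤ lam := by rw [hlam]; positivity
  have hsub : lam = mu + β := by rw [hlam, hmu]; ring
  have hprod : lam * mu = -(k * γ) := by rw [hlam, hmu]; linarith
  have hk_eq : k = -(mu * (lam / γ)) := by field_simp; linarith
  have hu : ∀ t : ℝ, 0 ≤ t → HasDerivWithinAt (fun x => p x + mu * q x - lam / γ)
      ((k - k * γ * q t) + mu * (p t - β * q t)) (Set.Ici (0 : ℝ)) t := fun t ht =>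
    ((hodep t ht).add ((hodeq t ht).const_mul mu)).sub_const _
  have hregion : ∀ t : ℝ, 0 ≤ t → 0 ≤ p t + mu * q t - lam / γ := by
    intro t ht
    refine le_trans ?_ (mul_exp_le_of_hasDerivWithinAt_ge (c := mu) hu (fun s _ => ?_) ht)
    · exact mul_nonneg (by linarith) (Real.exp_pos _).le
    · refine le_of_eq ?_
      rw [hsub] at hprod hk_eq ⊢
      linear_combination -hk_eq + q s * hprod
  intro t ht
  refine ⟨?_, by linarith [hregion t ht]⟩
  refine lt_of_lt_of_le (mul_pos hq0 (Real.exp_pos _))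
    (mul_exp_le_of_hasDerivWithinAt_ge (c := -lam) hodeq (fun s hs => ?_) ht)
  have h := hregion s hs
  have h_div : 0 ≤ lam / γ := div_nonneg hlam_nonneg hγ.le
  have hmul : lam * q s = mu * q s + β * q s := by rw [hsub]; ring
  linarith
end

section
/- (Alignment comparison lemma, part i) Let k < 0, ν ≥ 0, γ > 0, β ≥ ν, and let c, a : [0, ∞) → ℝ be continuous with c(t) ≥ γ and ν + a(t) ≤ β for all t. Let T ∈ (0, ∞] and let w, s, p, q : [0, T) → ℝ be differentiable with w' = k - k c(t) s, s' = w - (ν + a(t)) s, p' = k - kγ q, and q' = p - β q on [0, T). Suppose s(t) ≥ 0 for all t ∈ [0, T). If s(0) > q(0) and w(0) > p(0), then s(t) > q(t) and w(t) > p(t) for all t ∈ [0, T). -/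
open Set in
/-- Two functions, positive at `0`, whose derivatives are nonnegative at every point where both are
positive stay positive. -/
theorem pos_pair_of_hasDerivAt {f g f' g' : ℝ → ℝ} {b : ℝ} (hb : 0 ≤ b)
    (hfc : ContinuousOn f (Icc 0 b)) (hgc : ContinuousOn g (Icc 0 b))
    (hf : ∀ t ∈ Ioo 0 b, HasDerivAt f (f' t) t) (hg : ∀ t ∈ Ioo 0 b, HasDerivAt g (g' t) t)
    (hf' : ∀ t ∈ Ioo 0 b, 0 < f t → 0 < g t → 0 ≤ f' t)
    (hg' : ∀ t ∈ Ioo 0 b, 0 < f t → 0 < g t → 0 ≤ g' t)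
    (hf0 : 0 < f 0) (hg0 : 0 < g 0) : 0 < f b ∧ 0 < g b := by
  by_contra hneg
  have hne : (Icc 0 b ∩ (fun t => min (f t) (g t)) ⁻¹' Iic 0).Nonempty := by
    refine ⟨b, ⟨hb, le_rfl⟩, ?_⟩
    rw [← lt_min_iff, not_lt] at hneg
    exact hneg
  have hcpt : IsCompact (Icc 0 b ∩ (fun t => min (f t) (g t)) ⁻¹' Iic 0) :=
    isCompact_Icc.of_isClosed_subset
      ((hfc.inf hgc).preimage_isClosed_of_isClosed isClosed_Icc isClosed_Iic) inter_subset_left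
  obtain ⟨τ, ⟨⟨hτ0, hτb⟩, hτ⟩, hleast⟩ := hcpt.exists_isLeast hne
  have hpos : ∀ t ∈ Ioo 0 τ, 0 < f t ∧ 0 < g t := by
    intro t ht
    rw [← lt_min_iff]
    by_contra hcon
    exact absurd (hleast ⟨⟨ht.1.le, ht.2.le.trans hτb⟩, not_lt.1 hcon⟩) (not_le.2 ht.2)
  have hsub : Icc 0 τ ⊆ Icc 0 b := Icc_subset_Icc_right hτb
  have hsub' : Ioo 0 τ ⊆ Ioo 0 b := Ioo_subset_Ioo_right hτb
  have hmf : MonotoneOn f (Icc 0 τ) := by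
    refine monotoneOn_of_hasDerivWithinAt_nonneg (f' := f') (convex_Icc 0 τ) (hfc.mono hsub) ?_ ?_
    all_goals rw [interior_Icc]; intro t ht
    · exact (hf t (hsub' ht)).hasDerivWithinAt
    · exact hf' t (hsub' ht) (hpos t ht).1 (hpos t ht).2
  have hmg : MonotoneOn g (Icc 0 τ) := by
    refine monotoneOn_of_hasDerivWithinAt_nonneg (f' := g') (convex_Icc 0 τ) (hgc.mono hsub) ?_ ?_
    all_goals rw [interior_Icc]; intro t ht
    · exact (hg t (hsub' ht)).hasDerivWithinAt
    · exact hg' t (hsub' ht) (hpos t ht).1 (hpos t ht).2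
  have h1 := hmf (left_mem_Icc.2 hτ0) (right_mem_Icc.2 hτ0) hτ0
  have h2 := hmg (left_mem_Icc.2 hτ0) (right_mem_Icc.2 hτ0) hτ0
  exact absurd (lt_min (hf0.trans_le h1) (hg0.trans_le h2)) (not_lt.2 hτ)


/-- Alignment comparison lemma, part i: with `c(t) ≥ γ` and
`ν + a(t) ≤ β`, if `s(0) > q(0)` and `w(0) > p(0)` then, as long as `s ≥ 0`,
`s(t) > q(t)` and `w(t) > p(t)` on `[0, T)`. -/
theorem alignment_comparison_lemma_i
    (k ν γ β : ℝ) (hk : k < 0) (hν : 0 ≤ ν) (hγ : 0 < γ) (hβν : ν ≤ β)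
    (c a : ℝ → ℝ) (hc_cont : Continuous c) (ha_cont : Continuous a)
    (hc : ∀ t : ℝ, 0 ≤ t → γ ≤ c t)
    (ha : ∀ t : ℝ, 0 ≤ t → ν + a t ≤ β)
    (T : EReal) (hT : 0 < T)
    (w s p q : ℝ → ℝ)
    (hodew : ∀ t : ℝ, 0 ≤ t → (t : EReal) < T →
      HasDerivWithinAt w (k - k * c t * s t) {u : ℝ | 0 ≤ u ∧ (u : EReal) < T} t)
    (hodes : ∀ t : ℝ, 0 ≤ t → (t : EReal) < T →
      HasDerivWithinAt s (w t - (ν + a t) * s t) {u : ℝ | 0 ≤ u ∧ (u : EReal) < T} t)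
    (hodep : ∀ t : ℝ, 0 ≤ t → (t : EReal) < T →
      HasDerivWithinAt p (k - k * γ * q t) {u : ℝ | 0 ≤ u ∧ (u : EReal) < T} t)
    (hodeq : ∀ t : ℝ, 0 ≤ t → (t : EReal) < T →
      HasDerivWithinAt q (p t - β * q t) {u : ℝ | 0 ≤ u ∧ (u : EReal) < T} t)
    (hs_nonneg : ∀ t : ℝ, 0 ≤ t → (t : EReal) < T → 0 ≤ s t)
    (hs0 : q 0 < s 0) (hw0 : p 0 < w 0) :
    ∀ t : ℝ, 0 ≤ t → (t : EReal) < T → q t < s t ∧ p t < w t := by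
  intro b hb hbT
  have hlt : ∀ t ≤ b, (t : EReal) < T := fun t ht =>
    (EReal.coe_le_coe_iff.2 ht).trans_lt hbT
  have hsub : Set.Icc 0 b ⊆ {u : ℝ | 0 ≤ u ∧ (u : EReal) < T} := fun t ht => ⟨ht.1, hlt t ht.2⟩
  have cont : ∀ {f f' : ℝ → ℝ}, (∀ t : ℝ, 0 ≤ t → (t : EReal) < T →
      HasDerivWithinAt f (f' t) {u : ℝ | 0 ≤ u ∧ (u : EReal) < T} t) →
      ContinuousOn f (Set.Icc 0 b) := fun h t ht =>
    ((h t ht.1 (hlt t ht.2)).mono hsub).continuousWithinAt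
  have deriv : ∀ {f f' : ℝ → ℝ}, (∀ t : ℝ, 0 ≤ t → (t : EReal) < T →
      HasDerivWithinAt f (f' t) {u : ℝ | 0 ≤ u ∧ (u : EReal) < T} t) →
      ∀ t ∈ Set.Ioo 0 b, HasDerivAt f (f' t) t := fun h t ht =>
    (h t ht.1.le (hlt t ht.2.le)).hasDerivAt
      (Filter.mem_of_superset (Icc_mem_nhds ht.1 ht.2) hsub)
  have hexp : ∀ t, HasDerivAt (fun t => Real.exp (β * t)) (Real.exp (β * t) * β) t := fun t => by
    simpa using ((hasDerivAt_id t).const_mul β).exp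
  have key := pos_pair_of_hasDerivAt (f := fun t => Real.exp (β * t) * (s t - q t))
    (g := fun t => w t - p t) hb
    ((by fun_prop : Continuous fun t => Real.exp (β * t)).continuousOn.mul
      ((cont hodes).sub (cont hodeq)))
    ((cont hodew).sub (cont hodep))
    (fun t ht => (hexp t).mul ((deriv hodes t ht).sub (deriv hodeq t ht)))
    (fun t ht => (deriv hodew t ht).sub (deriv hodep t ht))
    (fun t ht _ hg => ?_) (fun t ht hf _ => ?_) (by simpa using hs0) (by simpa using hw0)
  · exact ⟨sub_pos.1 ((mul_pos_iff_of_pos_left (Real.exp_pos _)).1 key.1), sub_pos.1 key.2⟩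
  · have hs := mul_nonneg (sub_nonneg.2 (ha t ht.1.le)) (hs_nonneg t ht.1.le (hlt t ht.2.le))
    have h := mul_nonneg (Real.exp_pos (β * t)).le
      (by linarith : 0 ≤ w t - p t + (β - (ν + a t)) * s t)
    linarith
  · have hd := (mul_pos_iff_of_pos_left (Real.exp_pos _)).1 hf
    have hs := mul_nonneg (sub_nonneg.2 (hc t ht.1.le)) (hs_nonneg t ht.1.le (hlt t ht.2.le))
    have h := mul_nonneg (neg_pos.2 hk).le
      (add_nonneg (mul_pos hγ hd).le hs)
    linarith
end

section
/- (Alignment comparison lemma, part ii) Let k < 0, ν ≥ 0, γ > 0, 0 ≤ β ≤ ν, and let c, a : [0, ∞) → ℝ be continuous with c(t) ≤ γ and ν + a(t) ≥ β for all t, where a(t) ≥ 0. Let T ∈ (0, ∞] and let w, s, p, q : [0, T) → ℝ be differentiable with w' = k - k c(t) s, s' = w - (ν + a(t)) s, p' = k - kγ q, and q' = p - β q on [0, T). Suppose s(t) ≥ 0 for all t ∈ [0, T). If s(0) < q(0) and w(0) < p(0), then s(t) < q(t) and w(t) < p(t) for all t ∈ [0, T). -/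
open Set in
/-- A cooperative pair of linear differential inequalities `P' ≥ κ Q`, `Q' ≥ P - β Q` with `κ ≥ 0`
preserves positivity. -/
theorem pos_of_cooperative_deriv_ge {κ β b : ℝ} (hκ : 0 ≤ κ) {P Q P' Q' : ℝ → ℝ}
    (hP : ∀ x ∈ Icc 0 b, HasDerivWithinAt P (P' x) (Icc 0 b) x)
    (hQ : ∀ x ∈ Icc 0 b, HasDerivWithinAt Q (Q' x) (Icc 0 b) x)
    (hP' : ∀ x ∈ Icc 0 b, κ * Q x ≤ P' x) (hQ' : ∀ x ∈ Icc 0 b, P x - β * Q x ≤ Q' x)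
    (hP0 : 0 < P 0) (hQ0 : 0 < Q 0) :
    ∀ x ∈ Icc 0 b, 0 < P x ∧ 0 < Q x := by
  by_contra! hcon
  obtain ⟨z, hz, hzPQ⟩ := hcon
  have hPc : ContinuousOn P (Icc 0 b) := fun x hx ↦ (hP x hx).continuousWithinAt
  have hQc : ContinuousOn Q (Icc 0 b) := fun x hx ↦ (hQ x hx).continuousWithinAt
  have hclosed : IsClosed (Icc 0 b ∩ (fun x ↦ min (P x) (Q x)) ⁻¹' Iic 0) :=
    (hPc.inf hQc).preimage_isClosed_of_isClosed isClosed_Icc isClosed_Iic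
  obtain ⟨x, ⟨hx, hxPQ⟩, hleast⟩ :=
    (isCompact_Icc.of_isClosed_subset hclosed inter_subset_left).exists_isLeast
      ⟨z, hz, min_le_iff.2 ((lt_or_ge 0 (P z)).elim (fun h ↦ .inr (hzPQ h)) .inl)⟩
  have hsub : Icc 0 x ⊆ Icc 0 b := Icc_subset_Icc_right hx.2
  have hpos : ∀ y ∈ Ioo 0 x, 0 < P y ∧ 0 < Q y := fun y hy ↦ by
    by_contra hy'
    refine (hleast ⟨hsub ⟨hy.1.le, hy.2.le⟩, ?_⟩).not_gt hy.2
    rw [← lt_min_iff, not_lt] at hy'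
    exact hy'
  have hmem0 : (0 : ℝ) ∈ Icc 0 x := ⟨le_rfl, hx.1⟩
  have hmemx : x ∈ Icc 0 x := ⟨hx.1, le_rfl⟩
  have hIoo : Ioo 0 x ⊆ Icc 0 b := Ioo_subset_Icc_self.trans hsub
  have hPmono : MonotoneOn P (Icc 0 x) := by
    refine monotoneOn_of_hasDerivWithinAt_nonneg (convex_Icc 0 x) (f' := P') (hPc.mono hsub)
      ?_ ?_ <;> rw [interior_Icc] <;> intro y hy
    · exact (hP y (hIoo hy)).mono hIoo
    · exact (mul_nonneg hκ (hpos y hy).2.le).trans (hP' y (hIoo hy))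
  have hQmono : MonotoneOn (fun y ↦ Real.exp (β * y) * Q y) (Icc 0 x) := by
    refine monotoneOn_of_hasDerivWithinAt_nonneg (convex_Icc 0 x)
      (f' := fun y ↦ Real.exp (β * y) * (β * 1) * Q y + Real.exp (β * y) * Q' y)
      (ContinuousOn.mul (by fun_prop) (hQc.mono hsub)) ?_ ?_ <;>
      rw [interior_Icc] <;> intro y hy
    · exact (((hasDerivAt_id y).const_mul β).exp.hasDerivWithinAt).mul
        ((hQ y (hIoo hy)).mono hIoo)
    · have h : 0 ≤ β * Q y + Q' y := by linarith [hQ' y (hIoo hy), (hpos y hy).1]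
      linarith [mul_nonneg (Real.exp_pos (β * y)).le h]
  have hPx : 0 < P x := hP0.trans_le (hPmono hmem0 hmemx hx.1)
  have hQx : 0 < Q x := by
    have h := hQmono hmem0 hmemx hx.1
    simp only [mul_zero, Real.exp_zero, one_mul] at h
    exact pos_of_mul_pos_right (hQ0.trans_le h) (Real.exp_pos _).le
  exact (lt_min hPx hQx).not_ge hxPQ


/-- Alignment comparison lemma, part ii: with `c(t) ≤ γ`,
`a(t) ≥ 0` and `ν + a(t) ≥ β` where `0 ≤ β ≤ ν`, if `s(0) < q(0)` and
`w(0) < p(0)` then, as long as `s ≥ 0`, `s(t) < q(t)` and `w(t) < p(t)` on `[0, T)`. -/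
theorem alignment_comparison_lemma_ii
    (k ν γ β : ℝ) (hk : k < 0) (hν : 0 ≤ ν) (hγ : 0 < γ)
    (hβ : 0 ≤ β) (hβν : β ≤ ν)
    (c a : ℝ → ℝ) (hc_cont : Continuous c) (ha_cont : Continuous a)
    (hc : ∀ t : ℝ, 0 ≤ t → c t ≤ γ)
    (ha_nonneg : ∀ t : ℝ, 0 ≤ t → 0 ≤ a t)
    (ha : ∀ t : ℝ, 0 ≤ t → β ≤ ν + a t)
    (T : EReal) (hT : 0 < T)
    (w s p q : ℝ → ℝ)
    (hodew : ∀ t : ℝ, 0 ≤ t → (t : EReal) < T →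
      HasDerivWithinAt w (k - k * c t * s t) {u : ℝ | 0 ≤ u ∧ (u : EReal) < T} t)
    (hodes : ∀ t : ℝ, 0 ≤ t → (t : EReal) < T →
      HasDerivWithinAt s (w t - (ν + a t) * s t) {u : ℝ | 0 ≤ u ∧ (u : EReal) < T} t)
    (hodep : ∀ t : ℝ, 0 ≤ t → (t : EReal) < T →
      HasDerivWithinAt p (k - k * γ * q t) {u : ℝ | 0 ≤ u ∧ (u : EReal) < T} t)
    (hodeq : ∀ t : ℝ, 0 ≤ t → (t : EReal) < T →
      HasDerivWithinAt q (p t - β * q t) {u : ℝ | 0 ≤ u ∧ (u : EReal) < T} t)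
    (hs_nonneg : ∀ t : ℝ, 0 ≤ t → (t : EReal) < T → 0 ≤ s t)
    (hs0 : s 0 < q 0) (hw0 : w 0 < p 0) :
    ∀ t : ℝ, 0 ≤ t → (t : EReal) < T → s t < q t ∧ w t < p t := by
  intro t ht htT
  have hlt : ∀ x ∈ Set.Icc 0 t, (x : EReal) < T := fun x hx ↦
    (EReal.coe_le_coe_iff.2 hx.2).trans_lt htT
  have hsub : Set.Icc 0 t ⊆ {u : ℝ | 0 ≤ u ∧ (u : EReal) < T} := fun x hx ↦ ⟨hx.1, hlt x hx⟩
  have key := pos_of_cooperative_deriv_ge (κ := -k * γ) (β := β) (b := t)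
    (P := p - w) (Q := q - s) (by nlinarith)
    (fun x hx ↦ ((hodep x hx.1 (hlt x hx)).sub (hodew x hx.1 (hlt x hx))).mono hsub)
    (fun x hx ↦ ((hodeq x hx.1 (hlt x hx)).sub (hodes x hx.1 (hlt x hx))).mono hsub)
    (fun x hx ↦ by
      have h := mul_nonneg (neg_nonneg.2 hk.le)
        (mul_nonneg (sub_nonneg.2 (hc x hx.1)) (hs_nonneg x hx.1 (hlt x hx)))
      simp only [Pi.sub_apply]
      linarith)
    (fun x hx ↦ by
      have h := mul_nonneg (sub_nonneg.2 (ha x hx.1)) (hs_nonneg x hx.1 (hlt x hx))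
      simp only [Pi.sub_apply]
      linarith)
    (sub_pos.2 hw0) (sub_pos.2 hs0) t ⟨ht, le_rfl⟩
  exact ⟨sub_pos.1 key.2, sub_pos.1 key.1⟩
end

section
/- (Global regularity threshold for Euler–Poisson alignment along characteristics) Let k < 0, ν ≥ 0, 0 < c₁ ≤ c₂, 0 ≤ ψ_m ≤ ψ_M, and let c, a : [0, ∞) → ℝ be continuous with c₁ ≤ c(t) ≤ c₂ and ψ_m ≤ a(t) ≤ ψ_M for all t. Set λ_M = ((ν + ψ_M) + √((ν + ψ_M)² - 4kc₁))/2 and μ_M = (-(ν + ψ_M) + √((ν + ψ_M)² - 4kc₁))/2. Let T ∈ (0, ∞] and let ρ, G : [0, T) → ℝ be differentiable with ρ' = -ρ(G - ν - a(t)) and G' = -G(G - ν - a(t)) + k(ρ - c(t)) on [0, T). If ρ(0) ≥ 0 and G(0) > (λ_M/c₁) ρ(0) - μ_M, then for all t ∈ [0, T): G(t) > (λ_M/c₁) ρ(t) - μ_M (in particular G(t) ≥ -μ_M) and 0 ≤ ρ(t) ≤ ρ(0) e^{λ_M t}. -/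
open Set

/-- Differential Grönwall inequality from below, with an explicit primitive `P` of the rate `p`. -/
theorem mul_exp_le_of_mul_le_hasDerivWithinAt_s17 {f f' p P : ℝ → ℝ} {t : ℝ} (ht : 0 ≤ t)
    (hf : ∀ x ∈ Icc 0 t, HasDerivWithinAt f (f' x) (Icc 0 t) x)
    (hP : ∀ x ∈ Icc 0 t, HasDerivWithinAt P (p x) (Icc 0 t) x) (hP0 : P 0 = 0)
    (hle : ∀ x ∈ Icc 0 t, p x * f x ≤ f' x) :
    f 0 * Real.exp (P t) ≤ f t := by
  have hd : ∀ x ∈ Icc 0 t, HasDerivWithinAt (fun y => f y * Real.exp (-P y))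
      (f' x * Real.exp (-P x) + f x * (Real.exp (-P x) * -p x)) (Icc 0 t) x :=
    fun x hx => (hf x hx).mul (hP x hx).neg.exp
  have hmono : MonotoneOn (fun y => f y * Real.exp (-P y)) (Icc 0 t) := by
    refine monotoneOn_of_hasDerivWithinAt_nonneg (convex_Icc 0 t)
      (fun x hx => (hd x hx).continuousWithinAt)
      (fun x hx => (hd x (interior_subset hx)).mono interior_subset) fun x hx => ?_
    nlinarith [mul_nonneg (sub_nonneg.2 (hle x (interior_subset hx))) (Real.exp_pos (-P x)).le]
  have h := hmono (left_mem_Icc.2 ht) (right_mem_Icc.2 ht) ht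
  simp only [hP0, neg_zero, Real.exp_zero, mul_one] at h
  calc f 0 * Real.exp (P t) ≤ f t * Real.exp (-P t) * Real.exp (P t) := by gcongr
    _ = f t := by rw [mul_assoc, ← Real.exp_add]; simp

theorem exists_primitive_of_continuousOn_Icc {p : ℝ → ℝ} {t : ℝ} (ht : 0 ≤ t)
    (hp : ContinuousOn p (Icc 0 t)) :
    ∃ P : ℝ → ℝ, P 0 = 0 ∧ ∀ x ∈ Icc 0 t, HasDerivWithinAt P (p x) (Icc 0 t) x := by
  have hc : Continuous (IccExtend ht ((Icc 0 t).domRestrict p)) := hp.domRestrict.Icc_extend'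
  refine ⟨fun x => ∫ y in (0 : ℝ)..x, IccExtend ht ((Icc 0 t).domRestrict p) y, by simp,
    fun x hx => ?_⟩
  have h := (hc.integral_hasStrictDerivAt 0 x).hasDerivAt.hasDerivWithinAt (s := Icc 0 t)
  rwa [IccExtend_of_mem ht _ hx] at h

/-- Global regularity threshold for Euler–Poisson alignment along
characteristics: for `ρ' = -ρ(G - ν - a(t))`, `G' = -G(G - ν - a(t)) + k(ρ - c(t))`
with `c₁ ≤ c(t) ≤ c₂` and `ψ_m ≤ a(t) ≤ ψ_M`, subcritical data
`ρ(0) ≥ 0`, `G(0) > (λ_M/c₁)ρ(0) - μ_M` yield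
`G(t) > (λ_M/c₁)ρ(t) - μ_M` (in particular `G(t) ≥ -μ_M`) and
`0 ≤ ρ(t) ≤ ρ(0)e^{λ_M t}` on `[0, T)`. -/
theorem alignment_global_regularity_threshold
    (k ν c₁ c₂ ψm ψM : ℝ) (hk : k < 0) (hν : 0 ≤ ν)
    (hc₁ : 0 < c₁) (hc₁₂ : c₁ ≤ c₂) (hψm : 0 ≤ ψm) (hψ : ψm ≤ ψM)
    (c a : ℝ → ℝ) (hc_cont : Continuous c) (ha_cont : Continuous a)
    (hc : ∀ t : ℝ, 0 ≤ t → c₁ ≤ c t ∧ c t ≤ c₂)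
    (ha : ∀ t : ℝ, 0 ≤ t → ψm ≤ a t ∧ a t ≤ ψM)
    (lamM muM : ℝ)
    (hlamM : lamM = ((ν + ψM) + Real.sqrt ((ν + ψM) ^ 2 - 4 * k * c₁)) / 2)
    (hmuM : muM = (-(ν + ψM) + Real.sqrt ((ν + ψM) ^ 2 - 4 * k * c₁)) / 2)
    (T : EReal) (hT : 0 < T)
    (ρ G : ℝ → ℝ)
    (hodeρ : ∀ t : ℝ, 0 ≤ t → (t : EReal) < T →
      HasDerivWithinAt ρ (-(ρ t) * (G t - ν - a t))
        {u : ℝ | 0 ≤ u ∧ (u : EReal) < T} t)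
    (hodeG : ∀ t : ℝ, 0 ≤ t → (t : EReal) < T →
      HasDerivWithinAt G (-(G t) * (G t - ν - a t) + k * (ρ t - c t))
        {u : ℝ | 0 ≤ u ∧ (u : EReal) < T} t)
    (hρ0 : 0 ≤ ρ 0)
    (hG0 : (lamM / c₁) * ρ 0 - muM < G 0) :
    ∀ t : ℝ, 0 ≤ t → (t : EReal) < T →
      ((lamM / c₁) * ρ t - muM < G t ∧ -muM ≤ G t) ∧
      0 ≤ ρ t ∧ ρ t ≤ ρ 0 * Real.exp (lamM * t) := by
  intro t ht htT
  set s := Real.sqrt ((ν + ψM) ^ 2 - 4 * k * c₁) with hs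
  have hkc : k * c₁ < 0 := mul_neg_of_neg_of_pos hk hc₁
  have hb : 0 ≤ ν + ψM := by linarith
  have hs2 : s ^ 2 = (ν + ψM) ^ 2 - 4 * k * c₁ := Real.sq_sqrt (by nlinarith [sq_nonneg (ν + ψM)])
  have hbs : ν + ψM ≤ s := Real.le_sqrt_of_sq_le (by nlinarith)
  have hmu : 0 ≤ muM := by linarith
  have hlam : 0 ≤ lamM := by linarith
  have hsub : lamM - muM = ν + ψM := by linarith
  have hmul : lamM * muM = -k * c₁ := by rw [hlamM, hmuM]; linear_combination hs2 / 4
  have hsubset : Icc 0 t ⊆ {u : ℝ | 0 ≤ u ∧ (u : EReal) < T} := fun u hu =>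
    ⟨hu.1, lt_of_le_of_lt (EReal.coe_le_coe_iff.2 hu.2) htT⟩
  have hdρ : ∀ x ∈ Icc 0 t, HasDerivWithinAt ρ (-(ρ x) * (G x - ν - a x)) (Icc 0 t) x :=
    fun x hx => (hodeρ x hx.1 (hsubset hx).2).mono hsubset
  have hdG : ∀ x ∈ Icc 0 t, HasDerivWithinAt G
      (-(G x) * (G x - ν - a x) + k * (ρ x - c x)) (Icc 0 t) x :=
    fun x hx => (hodeG x hx.1 (hsubset hx).2).mono hsubset
  have hcontG : ContinuousOn G (Icc 0 t) := fun x hx => (hdG x hx).continuousWithinAt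
  have hsubIcc : ∀ x ∈ Icc 0 t, Icc 0 x ⊆ Icc 0 t := fun x hx => Icc_subset_Icc_right hx.2
  have hρ_nonneg : ∀ x ∈ Icc 0 t, 0 ≤ ρ x := by
    intro x hx
    obtain ⟨P, hP0, hP⟩ := exists_primitive_of_continuousOn_Icc
      (p := fun y => -(G y - ν - a y)) ht (by fun_prop)
    have h := mul_exp_le_of_mul_le_hasDerivWithinAt_s17 hx.1
      (fun y hy => (hdρ y (hsubIcc x hx hy)).mono (hsubIcc x hx))
      (fun y hy => (hP y (hsubIcc x hx hy)).mono (hsubIcc x hx)) hP0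
      (fun y _ => le_of_eq (by ring))
    exact (mul_nonneg hρ0 (Real.exp_pos _).le).trans h
  have hgap : ∀ x ∈ Icc 0 t, lamM / c₁ * ρ x - muM < G x := by
    intro x hx
    obtain ⟨P, hP0, hP⟩ := exists_primitive_of_continuousOn_Icc
      (p := fun y => muM - (G y - ν - a y)) ht (by fun_prop)
    have h := mul_exp_le_of_mul_le_hasDerivWithinAt_s17 (f := fun y => G y - lamM / c₁ * ρ y + muM) hx.1
      (fun y hy => (((hdG y (hsubIcc x hx hy)).sub
        ((hdρ y (hsubIcc x hx hy)).const_mul (lamM / c₁))).add_const muM).mono (hsubIcc x hx))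
      (fun y hy => (hP y (hsubIcc x hx hy)).mono (hsubIcc x hx)) hP0 ?_
    · have hpos : 0 < G 0 - lamM / c₁ * ρ 0 + muM := by linarith
      have := (mul_pos hpos (Real.exp_pos (P x))).trans_le h
      linarith
    · intro y hy
      have hkρ : k * ρ y = -muM * (lamM / c₁ * ρ y) := by
        field_simp
        linear_combination ρ y * hmul
      have hay : 0 ≤ muM * (ψM - a y) := mul_nonneg hmu (sub_nonneg.2 (ha y hy.1).2)
      have hcy : 0 ≤ -k * (c y - c₁) :=
        mul_nonneg (neg_nonneg.2 hk.le) (sub_nonneg.2 (hc y hy.1).1)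
      have hmu2 : muM * (lamM - muM) = muM * (ν + ψM) := by rw [hsub]
      linarith
  have hG_lower : ∀ x ∈ Icc 0 t, -muM ≤ G x := fun x hx => by
    linarith [hgap x hx, mul_nonneg (div_nonneg hlam hc₁.le) (hρ_nonneg x hx)]
  have htmem : t ∈ Icc 0 t := right_mem_Icc.2 ht
  refine ⟨⟨hgap t htmem, hG_lower t htmem⟩, hρ_nonneg t htmem, ?_⟩
  have h := mul_exp_le_of_mul_le_hasDerivWithinAt_s17 (p := fun _ => lamM) (P := fun y => lamM * y) ht
    (fun x hx => (hdρ x hx).neg)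
    (fun x _ => by simpa using (hasDerivWithinAt_id x (Icc 0 t)).const_mul lamM) (mul_zero _) ?_
  · simp only [Pi.neg_apply] at h
    linarith
  · intro x hx
    have hrate : 0 ≤ ρ x * (lamM + (G x - ν - a x)) :=
      mul_nonneg (hρ_nonneg x hx) (by linarith [hG_lower x hx, (ha x hx.1).2])
    simp only [Pi.neg_apply]
    linarith
end

section
/- (Unconditional upper bound on G) Let k < 0, ν ≥ 0, c₂ > 0, ψ_M ≥ 0, and let c, a : [0, ∞) → ℝ be continuous with 0 < c(t) ≤ c₂ and 0 ≤ a(t) ≤ ψ_M for all t. Let T ∈ (0, ∞] and let ρ, G : [0, T) → ℝ be differentiable with ρ(t) ≥ 0 and ρ' = -ρ(G - ν - a(t)), G' = -G(G - ν - a(t)) + k(ρ - c(t)) on [0, T). Then for all t ∈ [0, T), G(t) ≤ max{ G(0), ((ν + ψ_M) + √((ν + ψ_M)² - 4kc₂))/2 }. -/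
/-- Unconditional upper bound on `G`: for the alignment
characteristic system `ρ' = -ρ(G - ν - a(t))`, `G' = -G(G - ν - a(t)) + k(ρ - c(t))`
with `ρ ≥ 0`, `0 < c(t) ≤ c₂` and `0 ≤ a(t) ≤ ψ_M`, one has
`G(t) ≤ max{G(0), ((ν + ψ_M) + √((ν + ψ_M)² - 4kc₂))/2}` on `[0, T)`. -/
theorem alignment_unconditional_upper_bound
    (k ν c₂ ψM : ℝ) (hk : k < 0) (hν : 0 ≤ ν) (hc₂ : 0 < c₂) (hψM : 0 ≤ ψM)
    (c a : ℝ → ℝ) (hc_cont : Continuous c) (ha_cont : Continuous a)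
    (hc : ∀ t : ℝ, 0 ≤ t → 0 < c t ∧ c t ≤ c₂)
    (ha : ∀ t : ℝ, 0 ≤ t → 0 ≤ a t ∧ a t ≤ ψM)
    (T : EReal) (hT : 0 < T)
    (ρ G : ℝ → ℝ)
    (hρ_nonneg : ∀ t : ℝ, 0 ≤ t → (t : EReal) < T → 0 ≤ ρ t)
    (hodeρ : ∀ t : ℝ, 0 ≤ t → (t : EReal) < T →
      HasDerivWithinAt ρ (-(ρ t) * (G t - ν - a t))
        {u : ℝ | 0 ≤ u ∧ (u : EReal) < T} t)
    (hodeG : ∀ t : ℝ, 0 ≤ t → (t : EReal) < T →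
      HasDerivWithinAt G (-(G t) * (G t - ν - a t) + k * (ρ t - c t))
        {u : ℝ | 0 ≤ u ∧ (u : EReal) < T} t) :
    ∀ t : ℝ, 0 ≤ t → (t : EReal) < T →
      G t ≤ max (G 0) (((ν + ψM) + Real.sqrt ((ν + ψM) ^ 2 - 4 * k * c₂)) / 2) := by
  intro t ht htT
  refine le_of_forall_gt_imp_ge_of_dense fun B hB => ?_
  obtain ⟨hB0, hBr⟩ := max_lt_iff.mp hB
  have hkc : 0 ≤ -k * c₂ := mul_nonneg (neg_nonneg.mpr hk.le) hc₂.le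
  have hs := Real.sqrt_nonneg ((ν + ψM) ^ 2 - 4 * k * c₂)
  have hs2 : Real.sqrt ((ν + ψM) ^ 2 - 4 * k * c₂) ^ 2 = (ν + ψM) ^ 2 - 4 * k * c₂ :=
    Real.sq_sqrt (by nlinarith [sq_nonneg (ν + ψM)])
  set s := Real.sqrt ((ν + ψM) ^ 2 - 4 * k * c₂)
  have hBpos : 0 < B := by linarith
  have hquad : -B ^ 2 + (ν + ψM) * B - k * c₂ < 0 := by
    nlinarith [mul_pos (show 0 < 2 * B - (ν + ψM) - s by linarith)
      (show 0 < 2 * B - (ν + ψM) + s by linarith)]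
  have hlt : ∀ u : ℝ, u ≤ t → (u : EReal) < T := fun u hu =>
    lt_of_le_of_lt (EReal.coe_le_coe_iff.mpr hu) htT
  refine image_le_of_deriv_right_lt_deriv_boundary (a := 0) (b := t) (f := G)
    (f' := fun x => -(G x) * (G x - ν - a x) + k * (ρ x - c x))
    (B := fun _ => B) (B' := fun _ => 0) ?_ ?_ hB0.le (fun x => hasDerivAt_const x B) ?_
    (Set.right_mem_Icc.mpr ht)
  · exact fun x hx => ((hodeG x hx.1 (hlt x hx.2)).continuousWithinAt).mono
      fun u hu => ⟨hu.1, hlt u hu.2⟩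
  · intro x hx
    have hd : HasDerivWithinAt G _ (Set.Icc x t) x := (hodeG x hx.1 (hlt x hx.2.le)).mono
      fun u hu => ⟨hx.1.trans hu.1, hlt u hu.2⟩
    exact hd.mono_of_mem_nhdsWithin (Icc_mem_nhdsGE hx.2)
  · intro x hx hGB
    have hGB' : G x = B := hGB
    have hkρ := mul_nonneg (neg_nonneg.mpr hk.le) (hρ_nonneg x hx.1 (hlt x hx.2.le))
    have hkc' := mul_le_mul_of_nonneg_left (hc x hx.1).2 (neg_nonneg.mpr hk.le)
    have haB := mul_le_mul_of_nonneg_left (ha x hx.1).2 hBpos.le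
    simp only [hGB']
    linarith
end
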